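/- arXiv:2310.10809 — 2 statements merged into one kernel-verified Lean document; each statement's English description precedes it below -/
import Mathlib

section
/- The embedded exit chain X_exit and entrance chain X_entrance each have a unique stationary distribution, denoted π_exit and π_entrance respectively, and these stationary distributions are integrable: Σ_{x∈ℤ} |x| π_exit(x) < ∞ and Σ_{x∈ℤ} |x| π_entrance(x) < ∞. -/
open MeasureTheory Filter
open scoped ENNReal

/-- `crossTimes d ι ω = (σ̃_ι, τ̃_ι)`: the `ι`-th membrane-crossing (exit) time
`σ̃_ι` and the `ι`-th entrance time `τ̃_ι` of a trajectory `ω`, where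
`σ̃₀ = 0`, `τ̃_ι = inf {k ≥ σ̃_ι : |ω k| > d}` and
`σ̃_{ι+1} = inf {k > τ̃_ι : (ω(k−1) > d ∧ ω k ≤ d) ∨ (ω(k−1) < −d ∧ ω k ≥ −d)}`. -/
noncomputable def crossTimes (d : ℤ) : ℕ → (ℕ → ℤ) → ℕ × ℕ
  | 0, ω => (0, sInf {k : ℕ | d < |ω k|})
  | ι + 1, ω =>
      let s := sInf {k : ℕ | (crossTimes d ι ω).2 < k ∧
        ((d < ω (k - 1) ∧ ω k ≤ d) ∨ (ω (k - 1) < -d ∧ -d ≤ ω k))}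
      (s, sInf {k : ℕ | s ≤ k ∧ d < |ω k|})

/-- The `n`-step transition probabilities of the kernel `K`. -/
noncomputable def iterK (K : ℤ → PMF ℤ) : ℕ → ℤ → PMF ℤ
  | 0, x => PMF.pure x
  | n + 1, x => (iterK K n x).bind K

/-- `π` is a stationary distribution of the embedded exit chain
`X_exit(ι) = X(σ̃_ι)`. -/
def ExitStationary (d : ℤ) (P : ℤ → Measure (ℕ → ℤ)) (π : Measure ℤ) : Prop :=
  IsProbabilityMeasure π ∧
  ∀ A : Set ℤ, ∑' x : ℤ, π {x} * P x {ω | ω (crossTimes d 1 ω).1 ∈ A} = π A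

/-- `π` is a stationary distribution of the embedded entrance chain
`X_entrance(ι) = X(τ̃_ι)`; it is a distribution on the state space
`ℤ ∖ {−d, …, d}` of that chain. -/
def EntranceStationary (d : ℤ) (P : ℤ → Measure (ℕ → ℤ)) (π : Measure ℤ) : Prop :=
  IsProbabilityMeasure π ∧ π {x : ℤ | |x| ≤ d} = 0 ∧
  ∀ A : Set ℤ, ∑' x : ℤ, π {x} * P x {ω | ω (crossTimes d 1 ω).2 ∈ A} = π A


namespace Membrane

/-- A finite sub-invariant vector of a stochastic matrix is invariant. -/
lemma inv_of_subinv (Q : ℤ → ℤ → ℝ≥0∞) (hQ : ∀ x, ∑' y, Q x y = 1) (ν : ℤ → ℝ≥0∞)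
    (hν : ∑' x, ν x ≠ ⊤) (h : ∀ y, ∑' x, ν x * Q x y ≤ ν y) (y : ℤ) :
    ∑' x, ν x * Q x y = ν y := by
  by_contra hne
  have hlt : ∑' x, ν x * Q x y < ν y := lt_of_le_of_ne (h y) hne
  have htot : ∑' y, ∑' x, ν x * Q x y = ∑' x, ν x := by
    rw [ENNReal.tsum_comm]
    simp [ENNReal.tsum_mul_left, hQ]
  have := ENNReal.tsum_lt_tsum (f := fun y => ∑' x, ν x * Q x y) (g := ν)
    (by rw [htot]; exact hν) h hlt
  rw [htot] at this
  exact lt_irrefl _ this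

/-- Uniqueness of the invariant distribution. -/
lemma unique_inv (Q : ℤ → ℤ → ℝ≥0∞) (hQ : ∀ x, ∑' y, Q x y = 1) (z : ℤ)
    (hz : ∀ μ : ℤ → ℝ≥0∞, ∑' x, μ x ≠ ⊤ → (∀ y, ∑' x, μ x * Q x y = μ y) →
      (∃ x, μ x ≠ 0) → μ z ≠ 0)
    (p q : ℤ → ℝ≥0∞) (hp : ∑' x, p x = 1) (hq : ∑' x, q x = 1)
    (hpi : ∀ y, ∑' x, p x * Q x y = p y) (hqi : ∀ y, ∑' x, q x * Q x y = q y) :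
    p = q := by
  set m : ℤ → ℝ≥0∞ := fun x => min (p x) (q x) with hm
  have hmp : ∀ x, m x ≤ p x := fun x => min_le_left _ _
  have hmq : ∀ x, m x ≤ q x := fun x => min_le_right _ _
  have hm1 : ∑' x, m x ≤ 1 := hp ▸ ENNReal.tsum_le_tsum hmp
  have hmt : ∑' x, m x ≠ ⊤ := ne_top_of_le_ne_top ENNReal.one_ne_top hm1
  have hmx : ∀ x, m x ≠ ⊤ := fun x => ENNReal.ne_top_of_tsum_ne_top hmt x
  have hmi : ∀ y, ∑' x, m x * Q x y = m y := by
    apply inv_of_subinv Q hQ m hmt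
    intro y
    refine le_min ?_ ?_
    · rw [← hpi y]
      exact ENNReal.tsum_le_tsum fun x => by gcongr; exact hmp x
    · rw [← hqi y]
      exact ENNReal.tsum_le_tsum fun x => by gcongr; exact hmq x
  have key : ∀ r : ℤ → ℝ≥0∞, ∑' x, r x = 1 → (∀ y, ∑' x, r x * Q x y = r y) →
      (∀ x, m x ≤ r x) → (∃ x, m x < r x) → m z < r z := by
    intro r hr hri hmr ⟨x, hx⟩
    have h1 := hz (fun x => r x - m x) ?_ ?_ ⟨x, (tsub_pos_of_lt hx).ne'⟩
    · exact tsub_pos_iff_lt.mp (pos_iff_ne_zero.mpr h1)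
    · exact ne_top_of_le_ne_top ENNReal.one_ne_top
        (hr ▸ ENNReal.tsum_le_tsum fun x => tsub_le_self)
    · intro y
      have hadd : ∑' x, (r x - m x) * Q x y + m y = r y := by
        rw [← hmi y, ← ENNReal.tsum_add, ← hri y]
        congr 1; ext x
        rw [← add_mul, tsub_add_cancel_of_le (hmr x)]
      rw [← hadd]
      exact (ENNReal.add_sub_cancel_right (hmx y)).symm
  have tot : ∀ r : ℤ → ℝ≥0∞, ∑' x, r x = 1 → (∀ x, m x ≤ r x) → ∑' x, m x = 1 → m = r := by
    intro r hr hmr hm1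
    by_contra hne
    obtain ⟨x, hx⟩ := Function.ne_iff.mp hne
    have := ENNReal.tsum_lt_tsum (f := m) (g := r) hmt hmr (lt_of_le_of_ne (hmr x) hx)
    rw [hm1, hr] at this
    exact lt_irrefl _ this
  by_cases h1 : ∑' x, m x = 1
  · rw [← tot p hp hmp h1, ← tot q hq hmq h1]
  · exfalso
    have ex : ∀ r : ℤ → ℝ≥0∞, ∑' x, r x = 1 → (∀ x, m x ≤ r x) → ∃ x, m x < r x := by
      intro r hr hmr
      by_contra hcon
      push Not at hcon
      exact h1 (by rw [← hr]; congr 1; ext x; exact le_antisymm (hmr x) (hcon x))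
    have hA := key p hp hpi hmp (ex p hp hmp)
    have hB := key q hq hqi hmq (ex q hq hmq)
    exact lt_irrefl (m z) (lt_min hA hB)

/-- Iterates of the matrix `Q` started at `0`. -/
noncomputable def itQ (Q : ℤ → ℤ → ℝ≥0∞) : ℕ → ℤ → ℝ≥0∞
  | 0, y => if y = 0 then 1 else 0
  | n + 1, y => ∑' x, itQ Q n x * Q x y

lemma itQ_sum (Q : ℤ → ℤ → ℝ≥0∞) (hQ : ∀ x, ∑' y, Q x y = 1) (n : ℕ) :
    ∑' y, itQ Q n y = 1 := by
  induction n with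
  | zero => simp [itQ]
  | succ n ih =>
    simp only [itQ]
    rw [ENNReal.tsum_comm]
    simp [ENNReal.tsum_mul_left, hQ, ih]

lemma itQ_V (Q : ℤ → ℤ → ℝ≥0∞) (hQ : ∀ x, ∑' y, Q x y = 1) (C : ℝ≥0∞)
    (hV : ∀ x : ℤ, ∑' y : ℤ, Q x y * (y.natAbs : ℝ≥0∞) ≤ 2⁻¹ * (x.natAbs : ℝ≥0∞) + C) (n : ℕ) :
    ∑' y : ℤ, itQ Q n y * (y.natAbs : ℝ≥0∞) ≤ 2 * C := by
  induction n with
  | zero =>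
    have : ∀ y : ℤ, itQ Q 0 y * (y.natAbs : ℝ≥0∞) = 0 := by
      intro y; by_cases h : y = 0 <;> simp [itQ, h]
    simp [this]
  | succ n ih =>
    simp only [itQ]
    calc ∑' y : ℤ, (∑' x, itQ Q n x * Q x y) * (y.natAbs : ℝ≥0∞)
        = ∑' x, itQ Q n x * ∑' y : ℤ, Q x y * (y.natAbs : ℝ≥0∞) := by
          simp_rw [← ENNReal.tsum_mul_right, ← ENNReal.tsum_mul_left]
          rw [ENNReal.tsum_comm]
          simp_rw [mul_assoc]
      _ ≤ ∑' x : ℤ, itQ Q n x * (2⁻¹ * (x.natAbs : ℝ≥0∞) + C) := by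
          gcongr with x; exact hV x
      _ = 2⁻¹ * (∑' x : ℤ, itQ Q n x * (x.natAbs : ℝ≥0∞)) + C := by
          simp_rw [mul_add, ENNReal.tsum_add, ENNReal.tsum_mul_right, itQ_sum Q hQ, one_mul]
          rw [← ENNReal.tsum_mul_left]
          congr 2; ext x; ring
      _ ≤ 2⁻¹ * (2 * C) + C := by gcongr
      _ = 2 * C := by
          rw [← mul_assoc, ENNReal.inv_mul_cancel (by simp) (by simp), one_mul, two_mul]

/-- Existence of an integrable invariant distribution. -/
lemma exists_inv (Q : ℤ → ℤ → ℝ≥0∞) (hQ : ∀ x, ∑' y, Q x y = 1) (C : ℝ≥0∞) (hC : C ≠ ⊤)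
    (hV : ∀ x : ℤ, ∑' y : ℤ, Q x y * (y.natAbs : ℝ≥0∞) ≤ 2⁻¹ * (x.natAbs : ℝ≥0∞) + C) :
    ∃ ν : ℤ → ℝ≥0∞, ∑' x, ν x = 1 ∧ (∀ y, ∑' x, ν x * Q x y = ν y) ∧
      ∑' x : ℤ, ν x * (x.natAbs : ℝ≥0∞) ≠ ⊤ := by
  -- Cesàro averages
  set c : ℕ → ℤ → ℝ≥0∞ := fun n y => ((n : ℝ≥0∞) + 1)⁻¹ * ∑ k ∈ Finset.range (n + 1), itQ Q k y
    with hc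
  have hn0 : ∀ n : ℕ, ((n : ℝ≥0∞) + 1) ≠ 0 := fun n => by simp
  have hnt : ∀ n : ℕ, ((n : ℝ≥0∞) + 1) ≠ ⊤ := fun n => by simp
  have hcf : ∀ (φ : ℤ → ℝ≥0∞) n, ∑' y, c n y * φ y =
      ((n : ℝ≥0∞) + 1)⁻¹ * ∑ k ∈ Finset.range (n + 1), ∑' y, itQ Q k y * φ y := by
    intro φ n
    simp only [hc, mul_assoc, ENNReal.tsum_mul_left, Finset.sum_mul]
    rw [Summable.tsum_finsetSum (fun _ _ => ENNReal.summable)]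
  have hc1 : ∀ n, ∑' y, c n y = 1 := by
    intro n
    have := hcf (fun _ => 1) n
    simp only [mul_one, itQ_sum Q hQ, Finset.sum_const, Finset.card_range, nsmul_eq_mul] at this
    rw [this]
    push_cast
    exact ENNReal.inv_mul_cancel (hn0 n) (hnt n)
  have hcV : ∀ n, ∑' y : ℤ, c n y * (y.natAbs : ℝ≥0∞) ≤ 2 * C := by
    intro n
    rw [hcf]
    calc _ ≤ ((n : ℝ≥0∞) + 1)⁻¹ * ∑ k ∈ Finset.range (n + 1), 2 * C := by
          gcongr with k; exact itQ_V Q hQ C hV k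
      _ = 2 * C := by
          simp only [Finset.sum_const, Finset.card_range, nsmul_eq_mul]
          push_cast
          rw [← mul_assoc, ENNReal.inv_mul_cancel (hn0 n) (hnt n), one_mul]
  have hcQ : ∀ n y, ∑' x, c n x * Q x y ≤ c n y + ((n : ℝ≥0∞) + 1)⁻¹ := by
    intro n y
    rw [hcf]
    have h1 : ∀ k, ∑' x, itQ Q k x * Q x y = itQ Q (k + 1) y := fun k => rfl
    simp only [h1, hc]
    have h2 : itQ Q (n + 1) y ≤ 1 := by
      rw [← itQ_sum Q hQ (n + 1)]; exact ENNReal.le_tsum y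
    calc _ ≤ ((n : ℝ≥0∞) + 1)⁻¹ * (∑ k ∈ Finset.range (n + 1), itQ Q k y + 1) := by
          gcongr
          calc ∑ k ∈ Finset.range (n + 1), itQ Q (k + 1) y
              ≤ ∑ k ∈ Finset.range (n + 1), itQ Q (k + 1) y + itQ Q 0 y := le_self_add
            _ = ∑ k ∈ Finset.range (n + 1), itQ Q k y + itQ Q (n + 1) y := by
                rw [← Finset.sum_range_succ' (fun k => itQ Q k y), Finset.sum_range_succ]
            _ ≤ _ := by gcongr
      _ = _ := by rw [mul_add, mul_one]
  -- limit along an ultrafilter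
  let U : Ultrafilter ℕ := hyperfilter ℕ
  have hU : (U : Filter ℕ) ≤ atTop := by
    rw [← Nat.cofinite_eq_atTop]; exact hyperfilter_le_cofinite
  have hlim : ∀ y, ∃ a, Tendsto (fun n => c n y) U (nhds a) := by
    intro y
    obtain ⟨a, -, ha⟩ := isCompact_univ.ultrafilter_le_nhds (U.map (fun n => c n y)) (by simp)
    exact ⟨a, ha⟩
  choose ν hν using hlim
  have hνle1 : ∑' y, ν y ≤ 1 := by
    refine ENNReal.summable.tsum_le_of_sum_le ?_
    intro s
    refine le_of_tendsto (tendsto_finsetSum s (fun y _ => hν y)) (Eventually.of_forall fun n => ?_)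
    rw [← hc1 n]; exact ENNReal.sum_le_tsum s
  have hνt : ∑' y, ν y ≠ ⊤ := ne_top_of_le_ne_top ENNReal.one_ne_top hνle1
  have hνy : ∀ y, ν y ≠ ⊤ := fun y => ENNReal.ne_top_of_tsum_ne_top hνt y
  have hνV : ∑' y : ℤ, ν y * (y.natAbs : ℝ≥0∞) ≤ 2 * C := by
    refine ENNReal.summable.tsum_le_of_sum_le ?_
    intro s
    refine le_of_tendsto (tendsto_finsetSum s (fun y _ =>
      ENNReal.Tendsto.mul_const (hν y) (Or.inr (by simp)))) (Eventually.of_forall fun n => ?_)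
    exact (ENNReal.sum_le_tsum s).trans (hcV n)
  have hQ1 : ∀ x y, Q x y ≠ ⊤ := fun x y =>
    ENNReal.ne_top_of_tsum_ne_top (by rw [hQ x]; simp) y
  have hνQ : ∀ y, ∑' x, ν x * Q x y ≤ ν y := by
    intro y
    refine ENNReal.summable.tsum_le_of_sum_le ?_
    intro s
    have hr : Tendsto (fun n : ℕ => c n y + ((n : ℝ≥0∞) + 1)⁻¹) U (nhds (ν y + 0)) := by
      refine (hν y).add (Tendsto.mono_left ?_ hU)
      have := ENNReal.tendsto_inv_nat_nhds_zero.comp (tendsto_add_atTop_nat 1)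
      refine this.congr fun n => ?_
      simp
    rw [add_zero] at hr
    refine le_of_tendsto_of_tendsto (tendsto_finsetSum s (fun x _ =>
      ENNReal.Tendsto.mul_const (hν x) (Or.inr (hQ1 x y)))) hr (Eventually.of_forall fun n => ?_)
    exact (ENNReal.sum_le_tsum s).trans (hcQ n y)
  have hνi := inv_of_subinv Q hQ ν hνt hνQ
  -- nonzero mass
  have hν0 : ∑' y, ν y ≠ 0 := by
    obtain ⟨R, hR⟩ := ENNReal.exists_nat_gt (show 2 * (2 * C) ≠ ⊤ by finiteness)
    have hR0 : (R : ℝ≥0∞) ≠ 0 := (lt_of_le_of_lt (zero_le) hR).ne'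
    let s : Finset ℤ := Finset.Icc (-(R : ℤ)) R
    have hs : ∀ n, (2 : ℝ≥0∞)⁻¹ ≤ ∑ y ∈ s, c n y := by
      intro n
      have h1 : ∑' y, c n y ≤ ∑ y ∈ s, c n y + (R : ℝ≥0∞)⁻¹ * ∑' y : ℤ, c n y * (y.natAbs : ℝ≥0∞) := by
        have h0 : ∑ y ∈ s, c n y = ∑' y, if y ∈ s then c n y else 0 := by
          rw [tsum_eq_sum (s := s) (by intro y hy; simp [hy])]
          exact Finset.sum_congr rfl (by intro y hy; simp [hy])
        rw [h0, ← ENNReal.tsum_mul_left, ← ENNReal.tsum_add]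
        refine ENNReal.tsum_le_tsum fun y => ?_
        by_cases hy : y ∈ s
        · simp [hy]
        · simp only [hy, if_false, zero_add]
          have : (R : ℝ≥0∞) ≤ (y.natAbs : ℝ≥0∞) := by
            have : R ≤ y.natAbs := by simp [s] at hy; omega
            exact_mod_cast this
          calc c n y = (R : ℝ≥0∞)⁻¹ * R * c n y := by
                rw [ENNReal.inv_mul_cancel hR0 (by simp), one_mul]
            _ = (R : ℝ≥0∞)⁻¹ * (c n y * R) := by ring
            _ ≤ _ := by gcongr
      have h2 : (R : ℝ≥0∞)⁻¹ * ∑' y : ℤ, c n y * (y.natAbs : ℝ≥0∞) ≤ 2⁻¹ := by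
        calc _ ≤ (R : ℝ≥0∞)⁻¹ * (2 * C) := by gcongr; exact hcV n
          _ = (R : ℝ≥0∞)⁻¹ * (2⁻¹ * (2 * (2 * C))) := by
              rw [← mul_assoc 2⁻¹ 2, ENNReal.inv_mul_cancel (by simp) (by simp), one_mul]
          _ ≤ (R : ℝ≥0∞)⁻¹ * (2⁻¹ * R) := by gcongr
          _ = (R : ℝ≥0∞)⁻¹ * R * 2⁻¹ := by ring
          _ = 2⁻¹ := by rw [ENNReal.inv_mul_cancel hR0 (by simp), one_mul]
      rw [hc1] at h1
      have h3 := h1.trans (add_le_add_right h2 _)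
      rw [← ENNReal.inv_two_add_inv_two] at h3
      exact (ENNReal.add_le_add_iff_right (by simp)).mp h3
    have h4 : (2 : ℝ≥0∞)⁻¹ ≤ ∑ y ∈ s, ν y :=
      ge_of_tendsto (tendsto_finsetSum s (fun y _ => hν y)) (Eventually.of_forall hs)
    have h5 := h4.trans (ENNReal.sum_le_tsum s)
    intro h0
    rw [h0] at h5
    simp at h5
  refine ⟨fun x => (∑' y, ν y)⁻¹ * ν x, ?_, ?_, ?_⟩
  · rw [ENNReal.tsum_mul_left, ENNReal.inv_mul_cancel hν0 hνt]
  · intro y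
    simp_rw [mul_assoc, ENNReal.tsum_mul_left, hνi]
  · simp_rw [mul_assoc, ENNReal.tsum_mul_left]
    exact ENNReal.mul_ne_top (ENNReal.inv_ne_top.mpr hν0)
      (ne_top_of_le_ne_top (by finiteness) hνV)

end Membrane

namespace Membrane

/-- Construction of the Lyapunov function. -/
lemma exists_lyap (k : ℤ → ℝ) (hk0 : ∀ y, 0 ≤ k y) (hk1 : HasSum k 1)
    (hint : Summable fun y : ℤ => |(y : ℝ)| * k y)
    (hmean : ∑' y : ℤ, (y : ℝ) * k y = 0)
    (hsq : Summable fun y : ℤ => (y : ℝ) ^ 2 * k y)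
    (hvar : 0 < ∑' y : ℤ, (y : ℝ) ^ 2 * k y) :
    ∃ (h : ℤ → ℝ) (C : ℝ), (∀ x, 0 ≤ h x) ∧ (∀ x : ℤ, x ≤ 0 → -(x : ℝ) ≤ h x) ∧
      (∀ x : ℤ, x > 0 → h x ≤ x / 2 + C) ∧ (∀ x : ℤ, x > 0 → (x : ℝ) / 4 ≤ h x) ∧
      ∀ x : ℤ, x > 0 → Summable (fun y => k y * h (x + y)) ∧ ∑' y, k y * h (x + y) < h x := by
  have hsumy : Summable fun y : ℤ => (y : ℝ) * k y := by
    refine Summable.of_norm ?_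
    refine hint.congr fun y => ?_
    rw [Real.norm_eq_abs, abs_mul, abs_of_nonneg (hk0 y)]
  have hmean' : HasSum (fun y : ℤ => (y : ℝ) * k y) 0 := hmean ▸ hsumy.hasSum
  -- negative part of the mean
  have hnegs : Summable fun y : ℤ => min (y : ℝ) 0 * k y := by
    refine Summable.of_norm_bounded hint fun y => ?_
    rw [Real.norm_eq_abs, abs_mul, abs_of_nonneg (hk0 y)]
    refine mul_le_mul_of_nonneg_right ?_ (hk0 y)
    rcases le_total (y : ℝ) 0 with h | h
    · rw [min_eq_left h]
    · rw [min_eq_right h, abs_zero]; exact abs_nonneg _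
  set e : ℝ := -∑' y : ℤ, min (y : ℝ) 0 * k y with he
  have hepos : 0 < e := by
    by_contra hcon
    have h1 : 0 ≤ e := by
      rw [he, ← tsum_neg]
      refine tsum_nonneg fun y => ?_
      have : min (y : ℝ) 0 ≤ 0 := min_le_right _ _
      nlinarith [hk0 y]
    have h2 : e = 0 := le_antisymm (not_lt.mp hcon) h1
    have hneg0 : HasSum (fun y : ℤ => -(min (y : ℝ) 0 * k y)) 0 := by
      have := hnegs.hasSum.neg
      rwa [← he, h2] at this
    have hz1 := (hasSum_zero_iff_of_nonneg (fun y => by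
      have : min (y : ℝ) 0 ≤ 0 := min_le_right _ _
      nlinarith [hk0 y])).mp hneg0
    have hz1' : ∀ y : ℤ, min (y : ℝ) 0 * k y = 0 := fun y => by
      have := congrFun hz1 y; simpa using this
    have hz2 := (hasSum_zero_iff_of_nonneg (f := fun y : ℤ => (y : ℝ) * k y) (fun y => by
      rcases le_total (y : ℝ) 0 with h | h
      · have := hz1' y; rw [min_eq_left h] at this; rw [this]
      · exact mul_nonneg h (hk0 y))).mp hmean'
    have hz3 : ∀ y : ℤ, (y : ℝ) ^ 2 * k y = 0 := fun y => by
      have := congrFun hz2 y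
      simp only [Pi.zero_apply] at this
      rw [pow_two, mul_assoc, this, mul_zero]
    simp [hz3] at hvar
  -- integrated tails
  set g : ℕ → ℝ := fun n => ∑' y : ℤ, max (-(y : ℝ) - n) 0 * k y with hg
  have hgs : ∀ n : ℕ, Summable fun y : ℤ => max (-(y : ℝ) - n) 0 * k y := by
    intro n
    refine Summable.of_nonneg_of_le (fun y => mul_nonneg (le_max_right _ _) (hk0 y)) (fun y => ?_) hint
    gcongr
    · exact hk0 y
    · refine max_le ?_ (abs_nonneg _)
      have := neg_abs_le (y : ℝ)
      have : (0 : ℝ) ≤ n := Nat.cast_nonneg n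
      linarith
  have hg0 : ∀ n, 0 ≤ g n := fun n => tsum_nonneg fun y => mul_nonneg (le_max_right _ _) (hk0 y)
  have hpt : ∀ (a : ℝ) (N : ℕ), ∑ n ∈ Finset.range N, max (a - n) 0 ≤ (max a 0) ^ 2 + max a 0 := by
    intro a N
    induction N generalizing a with
    | zero => simp; positivity
    | succ N ih =>
      rw [Finset.sum_range_succ']
      have h1 := ih (a - 1)
      have h2 : ∑ n ∈ Finset.range N, max (a - 1 - n) 0 =
          ∑ n ∈ Finset.range N, max (a - ((n + 1 : ℕ) : ℝ)) 0 := by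
        refine Finset.sum_congr rfl fun n _ => ?_
        push_cast; congr 1; ring
      rw [← h2]
      simp only [Nat.cast_zero, sub_zero]
      rcases le_total a 0 with h | h
      · rw [max_eq_right h]
        rw [max_eq_right (by linarith : a - 1 ≤ 0)] at h1
        linarith
      · rw [max_eq_left h]
        rcases le_total (a - 1) 0 with h' | h'
        · rw [max_eq_right h'] at h1; nlinarith
        · rw [max_eq_left h'] at h1; nlinarith
  have hgsum : Summable g := by
    refine summable_of_sum_range_le (c := ∑' y : ℤ, ((y : ℝ) ^ 2 * k y + |(y : ℝ)| * k y)) hg0 fun N => ?_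
    rw [hg, ← Summable.tsum_finsetSum (fun n _ => hgs n)]
    refine Summable.tsum_le_tsum (fun y => ?_) (summable_sum fun n _ => hgs n) (hsq.add hint)
    rw [← Finset.sum_mul, ← add_mul]
    refine mul_le_mul_of_nonneg_right ((hpt _ _).trans ?_) (hk0 y)
    have h1 : max (-(y : ℝ)) 0 ≤ |(y : ℝ)| := max_le (neg_le_abs _) (abs_nonneg _)
    have h0 : 0 ≤ max (-(y : ℝ)) 0 := le_max_right _ _
    have h2 : (max (-(y : ℝ)) 0) ^ 2 ≤ (y : ℝ) ^ 2 := by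
      rw [← sq_abs (y : ℝ)]; gcongr
    linarith
  set c : ℝ := 2 / e with hc
  have hcpos : 0 < c := by positivity
  set r : ℕ → ℝ := fun n => c * (g n + (1 / 2 : ℝ) ^ n) with hr
  have hrs : Summable r := (hgsum.add summable_geometric_two).mul_left c
  have hr0 : ∀ n, 0 ≤ r n := fun n => by
    have := hg0 n
    simp only [hr]; positivity
  obtain ⟨M, hM⟩ : ∃ M : ℕ, ∑' n, r (n + M) < 1 / 4 := by
    have := tendsto_sum_nat_add r
    exact (this.eventually (gt_mem_nhds (by norm_num : (0 : ℝ) < 1 / 4))).exists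
  set a : ℕ → ℝ := fun n => r (n + M) with ha
  have has : Summable a := (summable_nat_add_iff M).mpr hrs
  have ha0 : ∀ n, 0 ≤ a n := fun n => hr0 _
  set A : ℝ := ∑' n, a n with hA
  have hA0 : 0 ≤ A := tsum_nonneg ha0
  have hA1 : A < 1 / 4 := hM
  -- the concave part
  have hminabs : ∀ (x : ℤ) (n : ℕ), |min (x : ℝ) n| ≤ |(x : ℝ)| := by
    intro x n
    have hn : (0 : ℝ) ≤ n := Nat.cast_nonneg n
    rcases le_total (x : ℝ) n with h | h
    · rw [min_eq_left h]
    · rw [min_eq_right h, abs_of_nonneg hn, abs_of_nonneg (hn.trans h)]; exact h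
  have hFs : ∀ x : ℤ, Summable fun n : ℕ => a n * min (x : ℝ) n := by
    intro x
    refine Summable.of_norm_bounded (has.mul_right |(x : ℝ)|) fun n => ?_
    rw [Real.norm_eq_abs, abs_mul, abs_of_nonneg (ha0 n)]
    exact mul_le_mul_of_nonneg_left (hminabs x n) (ha0 n)
  set F : ℤ → ℝ := fun x => ∑' n : ℕ, a n * min (x : ℝ) n with hF
  have hFneg : ∀ x ≤ 0, F x = A * x := by
    intro x hx
    rw [hF, hA, ← tsum_mul_right]
    refine tsum_congr fun n => ?_
    have : (x : ℝ) ≤ 0 := by exact_mod_cast hx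
    rw [min_eq_left (this.trans (Nat.cast_nonneg n))]
  have hFle : ∀ x, F x ≤ A * x := by
    intro x
    rw [hF, hA, ← tsum_mul_right]
    exact Summable.tsum_le_tsum (fun n => mul_le_mul_of_nonneg_left (min_le_left _ _) (ha0 n))
      (hFs x) (has.mul_right _)
  have hFpos : ∀ x ≥ 0, 0 ≤ F x := by
    intro x hx
    have : (0 : ℝ) ≤ x := by exact_mod_cast hx
    exact tsum_nonneg fun n => mul_nonneg (ha0 n) (le_min this (Nat.cast_nonneg n))
  -- supergradient
  have hsup : ∀ m : ℕ, ∃ s : ℝ, ∀ y : ℤ,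
      F ((m : ℤ) + y) ≤ F m + y * s + a m * min (y : ℝ) 0 := by
    intro m
    have hss : Summable fun n : ℕ => if m < n then a n else 0 :=
      Summable.of_nonneg_of_le (fun n => by split_ifs <;> simp [ha0])
        (fun n => by split_ifs <;> simp [ha0]) has
    refine ⟨∑' n : ℕ, if m < n then a n else 0, fun y => ?_⟩
    have h1 : HasSum (fun n : ℕ => if n = m then a m * min (y : ℝ) 0 else 0) (a m * min (y : ℝ) 0) :=
      hasSum_ite_eq m _
    have h2 := (((hFs m).hasSum.add (hss.hasSum.mul_left (y : ℝ))).add h1)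
    refine hasSum_le (fun n => ?_) (hFs (m + y)).hasSum h2
    push_cast
    rcases lt_trichotomy n m with h | h | h
    · have h' : (n : ℝ) ≤ m := by exact_mod_cast h.le
      simp only [h.ne, if_false, not_lt.mpr h.le, mul_zero, add_zero]
      rw [min_eq_right h']
      exact mul_le_mul_of_nonneg_left (min_le_right _ _) (ha0 n)
    · subst h
      simp only [lt_irrefl, if_false, if_true, mul_zero, add_zero, min_self]
      rw [← mul_add]
      refine mul_le_mul_of_nonneg_left ?_ (ha0 n)
      rcases le_total (y : ℝ) 0 with h | h
      · rw [min_eq_left h]; exact min_le_left _ _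
      · rw [min_eq_right h, add_zero]; exact min_le_right _ _
    · have h' : (m : ℝ) ≤ n := by exact_mod_cast h.le
      simp only [h.ne', if_false, h, if_true, add_zero]
      rw [min_eq_left h', mul_comm (y : ℝ), ← mul_add]
      exact mul_le_mul_of_nonneg_left (min_le_left _ _) (ha0 n)
  set h : ℤ → ℝ := fun x => 2 * M + x / 4 + F x + 2 * max (-(x : ℝ) - M) 0 with hh
  have hMnn : (0 : ℝ) ≤ M := Nat.cast_nonneg M
  have hlow : ∀ x : ℤ, x ≤ 0 → -(x : ℝ) ≤ h x := by
    intro x hx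
    have hx' : (x : ℝ) ≤ 0 := by exact_mod_cast hx
    simp only [hh, hFneg x hx]
    have := le_max_left (-(x : ℝ) - M) 0
    nlinarith
  have hposeq : ∀ x : ℤ, x > 0 → h x = 2 * M + x / 4 + F x := by
    intro x hx
    have hx' : (0 : ℝ) < x := by exact_mod_cast hx
    simp only [hh]
    rw [max_eq_right (by linarith)]; ring
  have hquart : ∀ x : ℤ, x > 0 → (x : ℝ) / 4 ≤ h x := by
    intro x hx
    rw [hposeq x hx]
    linarith [hFpos x hx.le]
  have hnn : ∀ x, 0 ≤ h x := by
    intro x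
    rcases le_or_gt x 0 with hx | hx
    · have hx' : (x : ℝ) ≤ 0 := by exact_mod_cast hx
      linarith [hlow x hx]
    · have hx' : (0 : ℝ) < x := by exact_mod_cast hx
      linarith [hquart x hx]
  refine ⟨h, 2 * M, hnn, hlow, ?_, hquart, ?_⟩
  · intro x hx
    have hx' : (0 : ℝ) < x := by exact_mod_cast hx
    rw [hposeq x hx]
    nlinarith [hFle x]
  · intro x hx
    obtain ⟨m, rfl⟩ := Int.eq_ofNat_of_zero_le hx.le
    obtain ⟨s, hs⟩ := hsup m
    have hpw : ∀ y : ℤ, k y * h ((m : ℤ) + y) ≤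
        k y * h m + (1 / 4 + s) * ((y : ℝ) * k y) + a m * (min (y : ℝ) 0 * k y)
          + 2 * (max (-(y : ℝ) - ((m + M : ℕ) : ℝ)) 0 * k y) := by
      intro y
      have h1 : h ((m : ℤ) + y) ≤ h m + (1 / 4 + s) * y + a m * min (y : ℝ) 0 +
          2 * max (-(y : ℝ) - ((m + M : ℕ) : ℝ)) 0 := by
        rw [hposeq m hx]
        simp only [hh]
        have h2 := hs y
        push_cast
        have h3 : -((m : ℝ) + y) - M = -(y : ℝ) - (m + M) := by ring
        rw [h3]
        linarith
      have := mul_le_mul_of_nonneg_left h1 (hk0 y)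
      linarith
    have hR : HasSum (fun y : ℤ => k y * h m + (1 / 4 + s) * ((y : ℝ) * k y)
        + a m * (min (y : ℝ) 0 * k y) + 2 * (max (-(y : ℝ) - ((m + M : ℕ) : ℝ)) 0 * k y))
        (1 * h m + (1 / 4 + s) * 0 + a m * (-e) + 2 * g (m + M)) := by
      refine HasSum.add (HasSum.add (HasSum.add (hk1.mul_right _) (hmean'.mul_left _)) ?_) ?_
      · have := hnegs.hasSum.mul_left (a m)
        rwa [show ∑' y : ℤ, min (y : ℝ) 0 * k y = -e by rw [he]; ring] at this
      · exact (hgs (m + M)).hasSum.mul_left 2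
    have hS : Summable fun y => k y * h ((m : ℤ) + y) :=
      Summable.of_nonneg_of_le (fun y => mul_nonneg (hk0 y) (hnn _)) hpw hR.summable
    refine ⟨hS, lt_of_le_of_lt (hasSum_le hpw hS.hasSum hR) ?_⟩
    have h5 : a m * e = 2 * (g (m + M) + (1 / 2 : ℝ) ^ (m + M)) := by
      simp only [ha, hr, hc]
      field_simp
    have h6 : (0 : ℝ) < (1 / 2 : ℝ) ^ (m + M) := by positivity
    nlinarith

/-- A maximum principle. -/
lemma max_principle (D : Set ℤ) (k : ℤ → ℤ → ℝ) (hk0 : ∀ x y, 0 ≤ k x y)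
    (hk1 : ∀ x, HasSum (k x) 1) (u h : ℤ → ℝ) (hu0 : ∀ x, 0 ≤ u x) (hu1 : ∀ x, u x ≤ 1)
    (huD : ∀ x ∉ D, u x = 0) (hu : ∀ x ∈ D, u x = ∑' w, k x w * u w)
    (hh0 : ∀ x, 0 ≤ h x) (hhs : ∀ x ∈ D, Summable fun w => k x w * h w)
    (hh : ∀ x ∈ D, ∑' w, k x w * h w < h x)
    (hfin : ∀ R : ℝ, {x | x ∈ D ∧ h x ≤ R}.Finite) (x : ℤ) : u x = 0 := by
  by_contra hne
  have hxpos : 0 < u x := lt_of_le_of_ne (hu0 x) (Ne.symm hne)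
  have hxD : x ∈ D := by
    by_contra hx; exact hne (huD x hx)
  set η : ℝ := u x / (2 * (h x + 1)) with hη
  have hhx := hh0 x
  have hηpos : 0 < η := by positivity
  have hvx : 0 < u x - η * h x := by
    have : η * (2 * (h x + 1)) = u x := by rw [hη]; field_simp
    nlinarith
  have hbig : ∀ y, 0 < u y - η * h y → y ∈ D ∧ h y ≤ 1 / η := by
    intro y hy
    constructor
    · by_contra hyD
      rw [huD y hyD] at hy
      nlinarith [hh0 y]
    · rw [le_div_iff₀ hηpos]
      nlinarith [hu1 y]
  obtain ⟨z, hz, hmax⟩ := (hfin (1 / η)).exists_maximalFor (fun y => u y - η * h y) _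
    ⟨x, hbig x hvx⟩
  have hmax' : ∀ y, y ∈ D ∧ h y ≤ 1 / η → u y - η * h y ≤ u z - η * h z := by
    intro y hy
    rcases le_total (u y - η * h y) (u z - η * h z) with h1 | h1
    · exact h1
    · exact hmax hy h1
  have hzpos : 0 < u z - η * h z := lt_of_lt_of_le hvx (hmax' x (hbig x hvx))
  have hall : ∀ y, u y - η * h y ≤ u z - η * h z := by
    intro y
    by_cases hy : 0 < u y - η * h y
    · exact hmax' y (hbig y hy)
    · linarith
  have hus : Summable fun w => k z w * u w :=
    Summable.of_nonneg_of_le (fun w => mul_nonneg (hk0 z w) (hu0 w))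
      (fun w => by nlinarith [hk0 z w, hu1 w]) (hk1 z).summable
  have h1 := hus.hasSum.sub ((hhs z hz.1).hasSum.mul_left η)
  have h2 := (hk1 z).mul_right (u z - η * h z)
  have h3 := hasSum_le (fun w => by
    have := mul_le_mul_of_nonneg_left (hall w) (hk0 z w)
    linarith) h1 h2
  have h4 := hh z hz.1
  rw [← hu z hz.1] at h3
  nlinarith

end Membrane

namespace Membrane

/-- The shifted trajectory. -/
def sh (n : ℕ) (ω : ℕ → ℤ) : ℕ → ℤ := fun k => ω (k + n)

/-- `n` is the first exit time from `D`. -/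
def FE (D : Set ℤ) (n : ℕ) (ω : ℕ → ℤ) : Prop := (∀ k < n, ω k ∈ D) ∧ ω n ∉ D

/-- The trajectory after first exit from `D` at time `n` belongs to `C`. -/
def hitN (D : Set ℤ) (C : Set (ℕ → ℤ)) (n : ℕ) : Set (ℕ → ℤ) := {ω | FE D n ω ∧ sh n ω ∈ C}

/-- The trajectory after first exit from `D` belongs to `C`. -/
def hit (D : Set ℤ) (C : Set (ℕ → ℤ)) : Set (ℕ → ℤ) := ⋃ n, hitN D C n

/-- The initial point is in `A`. -/
def ini (A : Set ℤ) : Set (ℕ → ℤ) := {ω | ω 0 ∈ A}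

/-- The first-exit kernel. -/
noncomputable def G (P : ℤ → Measure (ℕ → ℤ)) (D : Set ℤ) (x z : ℤ) : ℝ≥0∞ := P x (hit D (ini {z}))

/-- The cylinder probabilities. -/
def Cyl (K : ℤ → PMF ℤ) (P : ℤ → Measure (ℕ → ℤ)) : Prop :=
  ∀ (x : ℤ) (n : ℕ) (path : ℕ → ℤ),
      P x {ω | ∀ k ≤ n, ω k = path k} =
        (if path 0 = x then 1 else 0) *
          ∏ k ∈ Finset.range n, K (path k) (path (k + 1))

lemma measurable_sh (n : ℕ) : Measurable (sh n) :=
  measurable_pi_lambda _ fun k => measurable_pi_apply (k + n)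

lemma measurableSet_coord (k : ℕ) (A : Set ℤ) : MeasurableSet {ω : ℕ → ℤ | ω k ∈ A} :=
  measurableSet_preimage (measurable_pi_apply k) (MeasurableSet.of_discrete)

lemma measurableSet_ini (A : Set ℤ) : MeasurableSet (ini A) := measurableSet_coord 0 A

lemma measurableSet_FE (D : Set ℤ) (n : ℕ) : MeasurableSet {ω | FE D n ω} := by
  have : {ω | FE D n ω} = (⋂ k, ⋂ (_ : k < n), {ω : ℕ → ℤ | ω k ∈ D}) ∩ {ω | ω n ∈ Dᶜ} := by
    ext ω; simp [FE]
  rw [this]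
  exact (MeasurableSet.iInter fun k => MeasurableSet.iInter fun _ => measurableSet_coord k D).inter
    (measurableSet_coord n Dᶜ)

lemma measurableSet_hitN (D : Set ℤ) {C : Set (ℕ → ℤ)} (hC : MeasurableSet C) (n : ℕ) :
    MeasurableSet (hitN D C n) :=
  (measurableSet_FE D n).inter (measurable_sh n hC)

lemma measurableSet_hit (D : Set ℤ) {C : Set (ℕ → ℤ)} (hC : MeasurableSet C) :
    MeasurableSet (hit D C) := MeasurableSet.iUnion fun n => measurableSet_hitN D hC n

lemma FE_unique {D : Set ℤ} {n m : ℕ} {ω : ℕ → ℤ} (h1 : FE D n ω) (h2 : FE D m ω) : n = m := by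
  rcases lt_trichotomy n m with h | h | h
  · exact absurd (h2.1 n h) h1.2
  · exact h
  · exact absurd (h1.1 m h) h2.2

lemma FE_succ {D : Set ℤ} {n : ℕ} {ω : ℕ → ℤ} : FE D (n + 1) ω ↔ ω 0 ∈ D ∧ FE D n (sh 1 ω) := by
  constructor
  · rintro ⟨h1, h2⟩
    exact ⟨h1 0 (by omega), fun k hk => h1 (k + 1) (by omega), h2⟩
  · rintro ⟨h0, h1, h2⟩
    refine ⟨fun k hk => ?_, h2⟩
    cases k with
    | zero => exact h0
    | succ k => exact h1 k (by omega)

lemma gen_cyl : (MeasurableSpace.pi : MeasurableSpace (ℕ → ℤ)) =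
    MeasurableSpace.generateFrom {s | ∃ (n : ℕ) (p : ℕ → ℤ), s = {ω | ∀ k ≤ n, ω k = p k}} := by
  apply le_antisymm
  · refine iSup_le fun i => ?_
    rw [← measurable_iff_comap_le]
    refine @measurable_to_countable' ℤ (ℕ → ℤ) _ _ (MeasurableSpace.generateFrom _) _ fun a => ?_
    have : (fun b : ℕ → ℤ => b i) ⁻¹' {a} =
        ⋃ l : List ℤ, ⋃ (_ : l.getD i 0 = a), {ω : ℕ → ℤ | ∀ k ≤ i, ω k = l.getD k 0} := by
      ext ω
      simp only [Set.mem_preimage, Set.mem_singleton_iff, Set.mem_iUnion, Set.mem_ofPred_eq,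
        exists_prop]
      constructor
      · intro h
        have hl : ∀ k ≤ i, ((List.range (i + 1)).map ω).getD k 0 = ω k := by
          intro k hk
          simp [List.getD, Nat.lt_succ_of_le hk]
        exact ⟨(List.range (i + 1)).map ω, by rw [hl i le_rfl, h], fun k hk => (hl k hk).symm⟩
      · rintro ⟨l, h1, h2⟩
        rw [h2 i le_rfl, h1]
    rw [this]
    refine MeasurableSet.iUnion fun l => MeasurableSet.iUnion fun _ => ?_
    exact MeasurableSpace.measurableSet_generateFrom ⟨i, _, rfl⟩
  · refine MeasurableSpace.generateFrom_le ?_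
    rintro s ⟨n, p, rfl⟩
    have : {ω : ℕ → ℤ | ∀ k ≤ n, ω k = p k} = ⋂ k, ⋂ (_ : k ≤ n), {ω : ℕ → ℤ | ω k ∈ ({p k} : Set ℤ)} := by
      ext ω; simp
    rw [this]
    exact MeasurableSet.iInter fun k => MeasurableSet.iInter fun _ => measurableSet_coord k _

section
variable {K : ℤ → PMF ℤ} {P : ℤ → Measure (ℕ → ℤ)} (hprob : ∀ x, IsProbabilityMeasure (P x))
  (hcyl : Cyl K P)

lemma ae_ini (hprob : ∀ x, IsProbabilityMeasure (P x)) (hcyl : Cyl K P) (x : ℤ) :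
    ∀ᵐ ω ∂(P x), ω 0 = x := by
  have h := hcyl x 0 (fun _ => x)
  simp at h
  exact (prob_compl_eq_zero_iff (measurableSet_coord 0 {x})).mpr h

lemma one_step (hprob : ∀ x, IsProbabilityMeasure (P x)) (hcyl : Cyl K P) (x : ℤ)
    {B : Set (ℕ → ℤ)} (hB : MeasurableSet B) :
    P x (sh 1 ⁻¹' B) = ∑' w, K x w * P w B := by
  have key : (P x).map (sh 1) = Measure.sum (fun w => K x w • P w) := by
    have : IsProbabilityMeasure ((P x).map (sh 1)) :=
      Measure.isProbabilityMeasure_map (measurable_sh 1).aemeasurable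
    refine ext_of_generate_finite _ gen_cyl ?_ ?_ ?_
    · rintro s ⟨n, p, rfl⟩ t ⟨m, q, rfl⟩ ⟨ω, h1, h2⟩
      refine ⟨max n m, ω, ?_⟩
      ext η
      simp only [Set.mem_inter_iff, Set.mem_ofPred_eq] at *
      constructor
      · rintro ⟨h3, h4⟩ k hk
        rcases le_max_iff.mp hk with h | h
        · rw [h3 k h, h1 k h]
        · rw [h4 k h, h2 k h]
      · intro h
        exact ⟨fun k hk => by rw [h k (le_max_of_le_left hk), h1 k hk],
          fun k hk => by rw [h k (le_max_of_le_right hk), h2 k hk]⟩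
    · rintro s ⟨n, p, rfl⟩
      have hs : MeasurableSet {ω : ℕ → ℤ | ∀ k ≤ n, ω k = p k} := by
        rw [gen_cyl]; exact MeasurableSpace.measurableSet_generateFrom ⟨n, p, rfl⟩
      rw [Measure.map_apply (measurable_sh 1) hs, Measure.sum_apply _ hs]
      simp only [Measure.smul_apply, smul_eq_mul]
      have h1 : P x (sh 1 ⁻¹' {ω | ∀ k ≤ n, ω k = p k}) =
          P x {ω | ∀ k ≤ n + 1, ω k = (fun k => Nat.casesOn k x p : ℕ → ℤ) k} := by
        apply measure_congr
        filter_upwards [ae_ini hprob hcyl x] with ω hω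
        apply propext
        change (∀ k ≤ n, ω (k + 1) = p k) ↔ (∀ k ≤ n + 1, ω k = (fun k => Nat.casesOn k x p : ℕ → ℤ) k)
        constructor
        · intro h k hk
          cases k with
          | zero => exact hω
          | succ k => exact h k (by omega)
        · intro h k hk
          exact h (k + 1) (by omega)
      rw [h1, hcyl, Finset.prod_range_succ']
      rw [tsum_eq_single (p 0)]
      · rw [hcyl]; simp [mul_comm]
      · intro w hw
        rw [hcyl, if_neg (Ne.symm hw)]; simp
    · rw [Measure.sum_apply _ MeasurableSet.univ]
      simp [(K x).tsum_coe]
  rw [← Measure.map_apply (measurable_sh 1) hB, key, Measure.sum_apply _ hB]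
  simp

lemma hitN_zero_out (hprob : ∀ x, IsProbabilityMeasure (P x)) (hcyl : Cyl K P) {D : Set ℤ} {x : ℤ}
    (hx : x ∉ D) (C : Set (ℕ → ℤ)) : P x (hitN D C 0) = P x C := by
  apply measure_congr
  filter_upwards [ae_ini hprob hcyl x] with ω hω
  apply propext
  change (FE D 0 ω ∧ ω ∈ C) ↔ ω ∈ C
  simp [FE, hω, hx]

lemma hitN_zero_in (hprob : ∀ x, IsProbabilityMeasure (P x)) (hcyl : Cyl K P) {D : Set ℤ} {x : ℤ}
    (hx : x ∈ D) (C : Set (ℕ → ℤ)) : P x (hitN D C 0) = 0 := by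
  rw [← measure_empty (μ := P x)]
  apply measure_congr
  filter_upwards [ae_ini hprob hcyl x] with ω hω
  apply propext
  change (FE D 0 ω ∧ ω ∈ C) ↔ False
  simp [FE, hω, hx]

lemma hitN_succ_out (hprob : ∀ x, IsProbabilityMeasure (P x)) (hcyl : Cyl K P) {D : Set ℤ} {x : ℤ}
    (hx : x ∉ D) (C : Set (ℕ → ℤ)) (n : ℕ) : P x (hitN D C (n + 1)) = 0 := by
  rw [← measure_empty (μ := P x)]
  apply measure_congr
  filter_upwards [ae_ini hprob hcyl x] with ω hω
  apply propext
  change (FE D (n + 1) ω ∧ _) ↔ False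
  rw [FE_succ, hω]
  simp [hx]

lemma hitN_succ_in (hprob : ∀ x, IsProbabilityMeasure (P x)) (hcyl : Cyl K P) {D : Set ℤ} {x : ℤ}
    (hx : x ∈ D) {C : Set (ℕ → ℤ)} (hC : MeasurableSet C) (n : ℕ) :
    P x (hitN D C (n + 1)) = ∑' w, K x w * P w (hitN D C n) := by
  rw [← one_step hprob hcyl x (measurableSet_hitN D hC n)]
  apply measure_congr
  filter_upwards [ae_ini hprob hcyl x] with ω hω
  apply propext
  change (FE D (n + 1) ω ∧ sh (n + 1) ω ∈ C) ↔ (FE D n (sh 1 ω) ∧ sh n (sh 1 ω) ∈ C)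
  rw [FE_succ, hω]
  have : sh n (sh 1 ω) = sh (n + 1) ω := rfl
  simp [hx, this]

lemma hit_eq_tsum (D : Set ℤ) {C : Set (ℕ → ℤ)} (hC : MeasurableSet C) (x : ℤ) :
    P x (hit D C) = ∑' n, P x (hitN D C n) := by
  refine measure_iUnion ?_ fun n => measurableSet_hitN D hC n
  intro n m hnm
  refine Set.disjoint_left.mpr ?_
  rintro ω ⟨h1, -⟩ ⟨h2, -⟩
  exact hnm (FE_unique h1 h2)

lemma hit_out (hprob : ∀ x, IsProbabilityMeasure (P x)) (hcyl : Cyl K P) {D : Set ℤ} {x : ℤ}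
    (hx : x ∉ D) {C : Set (ℕ → ℤ)} (hC : MeasurableSet C) : P x (hit D C) = P x C := by
  rw [hit_eq_tsum D hC, tsum_eq_zero_add' ENNReal.summable, hitN_zero_out hprob hcyl hx]
  simp [hitN_succ_out hprob hcyl hx]

lemma hit_in (hprob : ∀ x, IsProbabilityMeasure (P x)) (hcyl : Cyl K P) {D : Set ℤ} {x : ℤ}
    (hx : x ∈ D) {C : Set (ℕ → ℤ)} (hC : MeasurableSet C) :
    P x (hit D C) = ∑' w, K x w * P w (hit D C) := by
  rw [hit_eq_tsum D hC, tsum_eq_zero_add' ENNReal.summable, hitN_zero_in hprob hcyl hx, zero_add]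
  simp_rw [hitN_succ_in hprob hcyl hx hC, hit_eq_tsum D hC, ← ENNReal.tsum_mul_left]
  rw [ENNReal.tsum_comm]

lemma P_ini (hprob : ∀ x, IsProbabilityMeasure (P x)) (hcyl : Cyl K P) (x : ℤ) (A : Set ℤ) :
    P x (ini A) = A.indicator 1 x := by
  by_cases hx : x ∈ A
  · rw [Set.indicator_of_mem hx, Pi.one_apply, ← measure_univ (μ := P x)]
    apply measure_congr
    filter_upwards [ae_ini hprob hcyl x] with ω hω
    apply propext
    change ω 0 ∈ A ↔ True
    simp [hω, hx]
  · rw [Set.indicator_of_notMem hx, ← measure_empty (μ := P x)]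
    apply measure_congr
    filter_upwards [ae_ini hprob hcyl x] with ω hω
    apply propext
    change ω 0 ∈ A ↔ False
    simp [hω, hx]

/-- Strong Markov property at a first exit time, fixed time. -/
lemma markovN (hprob : ∀ x, IsProbabilityMeasure (P x)) (hcyl : Cyl K P) (D : Set ℤ)
    {C : Set (ℕ → ℤ)} (hC : MeasurableSet C) (n : ℕ) (x : ℤ) :
    P x (hitN D C n) = ∑' z, P x (hitN D (ini {z}) n) * P z C := by
  induction n generalizing x with
  | zero =>
    by_cases hx : x ∈ D
    · simp [hitN_zero_in hprob hcyl hx]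
    · simp only [hitN_zero_out hprob hcyl hx, P_ini hprob hcyl]
      rw [tsum_eq_single x]
      · simp
      · intro z hz; simp [Ne.symm hz]
  | succ n ih =>
    by_cases hx : x ∈ D
    · rw [hitN_succ_in hprob hcyl hx hC]
      simp_rw [hitN_succ_in hprob hcyl hx (measurableSet_ini _), ih, ← ENNReal.tsum_mul_left,
        ← ENNReal.tsum_mul_right]
      rw [ENNReal.tsum_comm]
      simp_rw [mul_assoc]
    · simp [hitN_succ_out hprob hcyl hx]

/-- Strong Markov property at a first exit time. -/
lemma markov (hprob : ∀ x, IsProbabilityMeasure (P x)) (hcyl : Cyl K P) (D : Set ℤ)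
    {C : Set (ℕ → ℤ)} (hC : MeasurableSet C) (x : ℤ) :
    P x (hit D C) = ∑' z, G P D x z * P z C := by
  rw [hit_eq_tsum D hC]
  simp_rw [markovN hprob hcyl D hC, G, hit_eq_tsum D (measurableSet_ini _), ← ENNReal.tsum_mul_right]
  rw [ENNReal.tsum_comm]

lemma G_out (hprob : ∀ x, IsProbabilityMeasure (P x)) (hcyl : Cyl K P) {D : Set ℤ} {x : ℤ}
    (hx : x ∉ D) (z : ℤ) : G P D x z = if z = x then 1 else 0 := by
  rw [G, hit_out hprob hcyl hx (measurableSet_ini _), P_ini hprob hcyl]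
  by_cases h : z = x
  · simp [h]
  · simp [h, Ne.symm h]

lemma G_in (hprob : ∀ x, IsProbabilityMeasure (P x)) (hcyl : Cyl K P) {D : Set ℤ} {x : ℤ}
    (hx : x ∈ D) (z : ℤ) : G P D x z = ∑' w, K x w * G P D w z :=
  hit_in hprob hcyl hx (measurableSet_ini _)

lemma G_mem {D : Set ℤ} {z : ℤ} (hz : z ∈ D) (x : ℤ) : G P D x z = 0 := by
  have : hit D (ini {z}) = ∅ := by
    ext ω
    simp only [hit, hitN, Set.mem_iUnion, Set.mem_ofPred_eq, Set.mem_empty_iff_false, iff_false]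
    rintro ⟨n, h1, h2⟩
    simp only [ini, sh, Set.mem_ofPred_eq, Set.mem_singleton_iff, zero_add] at h2
    exact h1.2 (h2 ▸ hz)
  rw [G, this, measure_empty]

lemma G_tsum (hprob : ∀ x, IsProbabilityMeasure (P x)) (hcyl : Cyl K P) (D : Set ℤ) (x : ℤ) :
    ∑' z, G P D x z = P x (hit D Set.univ) := by
  rw [markov hprob hcyl D MeasurableSet.univ]
  simp

/-- Supersolution bound. -/
lemma G_super (hprob : ∀ x, IsProbabilityMeasure (P x)) (hcyl : Cyl K P) (D : Set ℤ)
    (φ h : ℤ → ℝ≥0∞) (h1 : ∀ x ∈ D, ∑' w, K x w * h w ≤ h x) (h2 : ∀ y ∉ D, φ y ≤ h y) (x : ℤ) :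
    ∑' z, G P D x z * φ z ≤ h x := by
  have h3 : ∀ x, ∑' z, G P D x z * φ z = ∑' n, ∑' z, P x (hitN D (ini {z}) n) * φ z := by
    intro x
    simp_rw [G, hit_eq_tsum D (measurableSet_ini _), ← ENNReal.tsum_mul_right]
    rw [ENNReal.tsum_comm]
  rw [h3, ENNReal.tsum_eq_iSup_nat]
  refine iSup_le fun N => ?_
  induction N generalizing x with
  | zero => simp
  | succ N ih =>
    rw [Finset.sum_range_succ']
    by_cases hx : x ∈ D
    · refine le_trans ?_ (h1 x hx)
      simp only [hitN_zero_in hprob hcyl hx, zero_mul, tsum_zero, add_zero]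
      have : ∀ n, ∑' z, P x (hitN D (ini {z}) (n + 1)) * φ z =
          ∑' w, K x w * ∑' z, P w (hitN D (ini {z}) n) * φ z := by
        intro n
        simp_rw [hitN_succ_in hprob hcyl hx (measurableSet_ini _), ← ENNReal.tsum_mul_left,
          ← ENNReal.tsum_mul_right]
        rw [ENNReal.tsum_comm]
        simp_rw [mul_assoc]
      simp_rw [this]
      rw [← Summable.tsum_finsetSum (fun _ _ => ENNReal.summable)]
      simp_rw [← Finset.mul_sum]
      gcongr with w
      exact ih w
    · refine le_trans ?_ (h2 x hx)
      simp only [hitN_succ_out hprob hcyl hx, zero_mul, tsum_zero, Finset.sum_const_zero, zero_add,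
        hitN_zero_out hprob hcyl hx, P_ini hprob hcyl]
      rw [tsum_eq_single x]
      · simp
      · intro z hz; simp [Ne.symm hz]

end

lemma hasSum_toReal_tsum (f : ℤ → ℝ≥0∞) (hf : ∑' w, f w ≠ ⊤) :
    HasSum (fun w => (f w).toReal) (∑' w, f w).toReal := by
  rw [ENNReal.tsum_toReal_eq fun a => ENNReal.ne_top_of_tsum_ne_top hf a]
  exact ENNReal.hasSum_toReal hf

/-- Exit from one side: full exit and the drift bound. -/
lemma side_gen {K : ℤ → PMF ℤ} {P : ℤ → Measure (ℕ → ℤ)}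
    (hprob : ∀ x, IsProbabilityMeasure (P x)) (hcyl : Cyl K P) (D : Set ℤ) (h : ℤ → ℝ) (C : ℝ)
    (hC : 0 ≤ C)
    (hh0 : ∀ x, 0 ≤ h x) (hhs : ∀ x ∈ D, Summable fun w => (K x w).toReal * h w)
    (hh : ∀ x ∈ D, ∑' w, (K x w).toReal * h w < h x)
    (hfin : ∀ R : ℝ, {x | x ∈ D ∧ h x ≤ R}.Finite)
    (hout : ∀ y ∉ D, |(y : ℝ)| ≤ h y) (hin : ∀ x ∈ D, h x ≤ |(x : ℝ)| / 2 + C) (x : ℤ) (hx : x ∈ D) :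
    ∑' z, G P D x z = 1 ∧
      ∑' z : ℤ, G P D x z * (z.natAbs : ℝ≥0∞) ≤ 2⁻¹ * (x.natAbs : ℝ≥0∞) + ENNReal.ofReal C := by
  have hnat : ∀ y : ℤ, (y.natAbs : ℝ≥0∞) = ENNReal.ofReal |(y : ℝ)| := by
    intro y
    rw [← ENNReal.ofReal_natCast, Nat.cast_natAbs, Int.cast_abs]
  have hKt : ∀ x w, K x w ≠ ⊤ := fun x w => PMF.apply_ne_top _ _
  have hK1 : ∀ x, HasSum (fun w => (K x w).toReal) 1 := by
    intro x
    have := hasSum_toReal_tsum (fun w => K x w) (by rw [(K x).tsum_coe]; simp)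
    rwa [(K x).tsum_coe, ENNReal.toReal_one] at this
  constructor
  · rw [G_tsum hprob hcyl]
    set p : ℤ → ℝ≥0∞ := fun x => P x (hit D Set.univ) with hp
    have hp1 : ∀ x, p x ≤ 1 := fun x => prob_le_one
    have hpt : ∀ x, p x ≠ ⊤ := fun x => ne_top_of_le_ne_top ENNReal.one_ne_top (hp1 x)
    have hr1 : ∀ x, (p x).toReal ≤ 1 := fun x => by
      have := ENNReal.toReal_mono ENNReal.one_ne_top (hp1 x); simpa using this
    have hu := max_principle D (fun x w => (K x w).toReal) (fun _ _ => ENNReal.toReal_nonneg) hK1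
      (fun x => 1 - (p x).toReal) h (fun x => by linarith [hr1 x])
      (fun x => by linarith [ENNReal.toReal_nonneg (a := p x)]) ?_ ?_ hh0 hhs hh hfin x
    · have : (p x).toReal = 1 := by linarith
      change p x = 1
      rw [← ENNReal.ofReal_toReal (hpt x), this, ENNReal.ofReal_one]
    · intro y hy
      simp [hp, hit_out hprob hcyl hy MeasurableSet.univ]
    · intro y hy
      have h1 : p y = ∑' w, K y w * p w := hit_in hprob hcyl hy MeasurableSet.univ
      have h2 : HasSum (fun w => (K y w * p w).toReal) (p y).toReal := by
        rw [h1]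
        exact hasSum_toReal_tsum _ (by rw [← h1]; exact hpt y)
      have h3 := (hK1 y).sub h2
      rw [← h3.tsum_eq]
      refine tsum_congr fun w => ?_
      rw [ENNReal.toReal_mul]; ring
  · refine (G_super hprob hcyl D (fun z => (z.natAbs : ℝ≥0∞)) (fun x => ENNReal.ofReal (h x)) ?_ ?_ x).trans ?_
    · intro y hy
      have : ∀ w, K y w * ENNReal.ofReal (h w) = ENNReal.ofReal ((K y w).toReal * h w) := by
        intro w
        rw [ENNReal.ofReal_mul ENNReal.toReal_nonneg, ENNReal.ofReal_toReal (hKt y w)]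
      simp_rw [this]
      rw [← ENNReal.ofReal_tsum_of_nonneg (fun w => mul_nonneg ENNReal.toReal_nonneg (hh0 w)) (hhs y hy)]
      exact ENNReal.ofReal_le_ofReal (hh y hy).le
    · intro y hy
      rw [hnat]
      exact ENNReal.ofReal_le_ofReal (hout y hy)
    · refine (ENNReal.ofReal_le_ofReal (hin x hx)).trans ?_
      rw [ENNReal.ofReal_add (by positivity) hC, hnat, div_eq_inv_mul,
        ENNReal.ofReal_mul (by norm_num), ENNReal.ofReal_inv_of_pos (by norm_num)]
      simp

end Membrane

namespace Membrane

/-- Exit from one side for the perturbed walk; `s = 1` or `s = -1`. -/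
lemma side_walk {K : ℤ → PMF ℤ} {P : ℤ → Measure (ℕ → ℤ)}
    (hprob : ∀ x, IsProbabilityMeasure (P x)) (hcyl : Cyl K P) (d : ℤ) (hd : 0 ≤ d)
    (s : ℤ) (hs : s = 1 ∨ s = -1) (k : ℤ → ℝ) (hk0 : ∀ y, 0 ≤ k y) (hk1 : HasSum k 1)
    (hK : ∀ x : ℤ, d < s * x → ∀ y : ℤ, (K x (x + s * y)).toReal = k y)
    (hint : Summable fun y : ℤ => |(y : ℝ)| * k y)
    (hmean : ∑' y : ℤ, (y : ℝ) * k y = 0)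
    (hsq : Summable fun y : ℤ => (y : ℝ) ^ 2 * k y)
    (hvar : 0 < ∑' y : ℤ, (y : ℝ) ^ 2 * k y) :
    ∃ C : ℝ≥0∞, C ≠ ⊤ ∧ ∀ x : ℤ, d < s * x → ∑' z, G P {x | d < s * x} x z = 1 ∧
      ∑' z : ℤ, G P {x | d < s * x} x z * (z.natAbs : ℝ≥0∞) ≤ 2⁻¹ * (x.natAbs : ℝ≥0∞) + C := by
  obtain ⟨h, C, h0, hneg, hle, hge, hsup⟩ := exists_lyap k hk0 hk1 hint hmean hsq hvar
  have hdR : (0 : ℝ) ≤ d := by exact_mod_cast hd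
  have hss : s * s = 1 := by rcases hs with rfl | rfl <;> norm_num
  have habs : ∀ x : ℤ, |((s * x : ℤ) : ℝ)| = |(x : ℝ)| := by
    intro x; rcases hs with rfl | rfl <;> simp
  let E : ℤ → ℤ ≃ ℤ := fun x =>
    { toFun := fun y => x + s * y
      invFun := fun w => s * (w - x)
      left_inv := fun y => by
        change s * (x + s * y - x) = y
        linear_combination y * hss
      right_inv := fun w => by
        change x + s * (s * (w - x)) = w
        linear_combination (w - x) * hss }
  have hE : ∀ x y, E x y = x + s * y := fun _ _ => rfl
  have hsum : ∀ x : ℤ, d < s * x → HasSum (fun w => (K x w).toReal * (h (s * w - d) + d))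
      (∑' y, k y * h ((s * x - d) + y) + 1 * d) := by
    intro x hx
    rw [← (E x).hasSum_iff]
    have := (hsup (s * x - d) (by linarith)).1.hasSum.add (hk1.mul_right (d : ℝ))
    refine this.congr_fun ?_ |> id
    intro y
    simp only [Function.comp, hE, hK x hx y]
    rw [show s * (x + s * y) - d = (s * x - d) + y by linear_combination y * hss]
    ring
  refine ⟨ENNReal.ofReal (|C| + d), ENNReal.ofReal_ne_top, fun x hx => ?_⟩
  refine side_gen hprob hcyl {x | d < s * x} (fun x => h (s * x - d) + d) (|C| + d)
    (by positivity) (fun x => by linarith [h0 (s * x - d)]) (fun x hx => (hsum x hx).summable)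
    ?_ ?_ ?_ ?_ x hx
  · intro x hx
    rw [(hsum x hx).tsum_eq]
    have hx' : d < s * x := hx
    have := (hsup (s * x - d) (by linarith)).2
    linarith
  · intro R
    obtain ⟨N, hN⟩ := exists_nat_gt (4 * R + d)
    refine (Set.finite_Icc (-(N : ℤ)) N).subset ?_
    rintro y ⟨hy1, hy2⟩
    have hy1' : d < s * y := hy1
    have h1 := hge (s * y - d) (by linarith)
    push_cast at h1
    have h2 : (s : ℝ) * y ≤ N := by linarith
    have h3 : s * y ≤ N := by exact_mod_cast h2
    rw [Set.mem_Icc]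
    rcases hs with rfl | rfl <;> constructor <;> linarith
  · intro y hy
    have hy' : s * y ≤ d := not_lt.mp hy
    have h1 := hneg (s * y - d) (by linarith)
    have h2 := h0 (s * y - d)
    rw [← habs y]
    push_cast at *
    have hy'' : (s : ℝ) * y ≤ d := by exact_mod_cast hy'
    rw [abs_le]
    constructor <;> linarith
  · intro y hy
    have hy' : d < s * y := hy
    have h1 := hle (s * y - d) (by linarith)
    rw [← habs y]
    have := le_abs_self C
    have := le_abs_self (((s * y : ℤ) : ℝ))
    push_cast at *
    linarith

/-- The membrane. -/
def Mem (d : ℤ) : Set ℤ := {x | |x| ≤ d}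

/-- The component of `ℤ` (positive side, negative side, membrane) that contains `x`. -/
def side (d x : ℤ) : Set ℤ :=
  if d < x then {y | d < 1 * y} else if x < -d then {y | d < (-1) * y} else Mem d

lemma mem_side (d x : ℤ) : x ∈ side d x := by
  unfold side
  split_ifs with h1 h2
  · change d < 1 * x; omega
  · change d < -1 * x; omega
  · change |x| ≤ d
    rw [abs_le]; omega

lemma side_mem {d x : ℤ} (hx : |x| ≤ d) : side d x = Mem d := by
  rw [abs_le] at hx
  unfold side
  rw [if_neg (by omega), if_neg (by omega)]

lemma side_eq {d x y : ℤ} (hd : 0 ≤ d) (h : y ∈ side d x) : side d y = side d x := by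
  unfold side at h ⊢
  split_ifs at h with h1 h2
  · have h' : d < 1 * y := h
    rw [if_pos (by omega), if_pos h1]
  · have h' : d < (-1) * y := h
    rw [if_neg (by omega), if_pos (by omega), if_neg h1, if_pos h2]
  · have h' : |y| ≤ d := h
    rw [abs_le] at h'
    rw [if_neg (by omega), if_neg (by omega), if_neg h1, if_neg h2]

lemma ct_zero {d : ℤ} {n : ℕ} {ω : ℕ → ℤ} (h : FE (Mem d) n ω) : (crossTimes d 0 ω).2 = n := by
  change sInf {k : ℕ | d < |ω k|} = n
  have h2 : d < |ω n| := not_le.mp h.2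
  refine IsLeast.csInf_eq ⟨h2, fun k hk => ?_⟩
  by_contra hlt
  have h1 : |ω k| ≤ d := h.1 k (not_le.mp hlt)
  exact absurd hk (not_lt.mpr h1)

lemma ct_one {d : ℤ} (hd : 0 ≤ d) {n m : ℕ} {ω : ℕ → ℤ} (hn : FE (Mem d) n ω)
    (hm : FE (side d (ω n)) m (sh n ω)) : (crossTimes d 1 ω).1 = m + n := by
  change sInf {k : ℕ | (crossTimes d 0 ω).2 < k ∧
        ((d < ω (k - 1) ∧ ω k ≤ d) ∨ (ω (k - 1) < -d ∧ -d ≤ ω k))} = m + n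
  rw [ct_zero hn]
  have hout : d < |ω n| := not_le.mp hn.2
  have hm0 : 0 < m := by
    rcases Nat.eq_zero_or_pos m with h | h
    · subst h
      refine absurd (mem_side d (ω n)) ?_
      have := hm.2
      simpa [sh] using this
    · exact h
  have h1 : ∀ k, n ≤ k → k < m + n → ω k ∈ side d (ω n) := by
    intro k hk1 hk2
    have := hm.1 (k - n) (by omega)
    simpa [sh, Nat.sub_add_cancel hk1] using this
  have h2 : ω (m + n) ∉ side d (ω n) := hm.2
  have h3 := h1 (m + n - 1) (by omega) (by omega)
  by_cases hp : d < ω n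
  · have hside : side d (ω n) = {y | d < 1 * y} := by unfold side; rw [if_pos hp]
    rw [hside] at h1 h2 h3
    have h1' : ∀ k, n ≤ k → k < m + n → d < 1 * ω k := h1
    have h2' : ¬ (d < 1 * ω (m + n)) := h2
    have h3' : d < 1 * ω (m + n - 1) := h3
    refine IsLeast.csInf_eq ⟨⟨by omega, Or.inl ⟨by omega, by omega⟩⟩, ?_⟩
    rintro k ⟨hk, hk2⟩
    by_contra hlt
    have a1 := h1' k hk.le (not_le.mp hlt)
    have a2 := h1' (k - 1) (by omega) (by omega)
    omega
  · have hneg : ω n < -d := by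
      rcases lt_abs.mp hout with h | h
      · exact absurd h hp
      · omega
    have hside : side d (ω n) = {y | d < (-1) * y} := by unfold side; rw [if_neg hp, if_pos hneg]
    rw [hside] at h1 h2 h3
    have h1' : ∀ k, n ≤ k → k < m + n → d < (-1) * ω k := h1
    have h2' : ¬ (d < (-1) * ω (m + n)) := h2
    have h3' : d < (-1) * ω (m + n - 1) := h3
    refine IsLeast.csInf_eq ⟨⟨by omega, Or.inr ⟨by omega, by omega⟩⟩, ?_⟩
    rintro k ⟨hk, hk2⟩
    by_contra hlt
    have a1 := h1' k hk.le (not_le.mp hlt)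
    have a2 := h1' (k - 1) (by omega) (by omega)
    omega

lemma ct_two {d : ℤ} (hd : 0 ≤ d) {n m l : ℕ} {ω : ℕ → ℤ} (hn : FE (Mem d) n ω)
    (hm : FE (side d (ω n)) m (sh n ω)) (hl : FE (Mem d) l (sh (m + n) ω)) :
    (crossTimes d 1 ω).2 = l + (m + n) := by
  change sInf {k : ℕ | (crossTimes d 1 ω).1 ≤ k ∧ d < |ω k|} = l + (m + n)
  rw [ct_one hd hn hm]
  refine IsLeast.csInf_eq ⟨⟨by omega, not_le.mp hl.2⟩, ?_⟩
  rintro k ⟨hk1, hk2⟩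
  by_contra hlt
  have := hl.1 (k - (m + n)) (by omega)
  simp only [sh, Nat.sub_add_cancel hk1] at this
  exact absurd hk2 (not_lt.mpr this)

end Membrane

namespace Membrane

/-- Vector times matrix. -/
noncomputable def vm (v : ℤ → ℝ≥0∞) (A : ℤ → ℤ → ℝ≥0∞) : ℤ → ℝ≥0∞ := fun y => ∑' x, v x * A x y

/-- Matrix times matrix. -/
noncomputable def mm (A B : ℤ → ℤ → ℝ≥0∞) : ℤ → ℤ → ℝ≥0∞ := fun x y => ∑' z, A x z * B z y

lemma mv_assoc (v : ℤ → ℝ≥0∞) (A : ℤ → ℤ → ℝ≥0∞) (φ : ℤ → ℝ≥0∞) :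
    ∑' y, (∑' x, v x * A x y) * φ y = ∑' x, v x * ∑' y, A x y * φ y := by
  simp_rw [← ENNReal.tsum_mul_right, ← ENNReal.tsum_mul_left]
  rw [ENNReal.tsum_comm]
  simp_rw [mul_assoc]

lemma vm_mm (v : ℤ → ℝ≥0∞) (A B : ℤ → ℤ → ℝ≥0∞) : vm v (mm A B) = vm (vm v A) B := by
  ext y
  exact (mv_assoc v A (fun z => B z y)).symm

lemma vm_sum (v : ℤ → ℝ≥0∞) (A : ℤ → ℤ → ℝ≥0∞) (hA : ∀ x, ∑' y, A x y = 1) :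
    ∑' y, vm v A y = ∑' x, v x := by
  have := mv_assoc v A (fun _ => 1)
  simpa [vm, hA] using this

lemma mm_sum (A B : ℤ → ℤ → ℝ≥0∞) (hA : ∀ x, ∑' y, A x y = 1) (hB : ∀ x, ∑' y, B x y = 1) (x : ℤ) :
    ∑' y, mm A B x y = 1 := by
  have := vm_sum (A x) B hB
  rw [hA x] at this
  exact this

lemma measure_tsum (π : Measure ℤ) (A : Set ℤ) : ∑' y, π {y} * A.indicator 1 y = π A := by
  rw [← π.tsum_indicator_apply_singleton A MeasurableSet.of_discrete]
  refine tsum_congr fun y => ?_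
  by_cases h : y ∈ A <;> simp [h]

lemma stat_conv (π : Measure ℤ) (R : ℤ → Set ℤ → ℝ≥0∞) (q : ℤ → ℤ → ℝ≥0∞)
    (hR : ∀ x A, π {x} * R x A = π {x} * ∑' y, q x y * A.indicator 1 y) :
    (∀ A : Set ℤ, ∑' x, π {x} * R x A = π A) ↔ vm (fun x => π {x}) q = fun y => π {y} := by
  have h1 : ∀ A : Set ℤ, ∑' x, π {x} * R x A = ∑' y, vm (fun x => π {x}) q y * A.indicator 1 y := by
    intro A
    simp_rw [hR]
    exact (mv_assoc _ _ _).symm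
  constructor
  · intro h
    ext y
    have h2 := h {y}
    rw [h1, tsum_eq_single y] at h2
    · simpa using h2
    · intro z hz; simp [hz]
  · intro h A
    rw [h1, h, measure_tsum]

lemma measure_ext_singleton (π ρ : Measure ℤ) (h : ∀ x, π {x} = ρ {x}) : π = ρ := by
  ext A _
  rw [← measure_tsum π, ← measure_tsum ρ]
  simp_rw [h]

lemma measure_sum_one (π : Measure ℤ) [IsProbabilityMeasure π] : ∑' x, π {x} = 1 := by
  have := measure_tsum π Set.univ
  simpa using this

lemma exists_measure (ν : ℤ → ℝ≥0∞) (hν : ∑' x, ν x = 1) :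
    ∃ π : Measure ℤ, IsProbabilityMeasure π ∧ ∀ x, π {x} = ν x := by
  let p : PMF ℤ := ⟨ν, hν ▸ ENNReal.summable.hasSum⟩
  refine ⟨p.toMeasure, inferInstance, fun x => ?_⟩
  rw [PMF.toMeasure_apply_singleton _ _ (MeasurableSet.of_discrete)]
  rfl

/-- First hit of another component: the trajectory after leaving its own component. -/
def sideHit (d : ℤ) (C : Set (ℕ → ℤ)) : Set (ℕ → ℤ) := {ω | ω ∈ hit (side d (ω 0)) C}

lemma measurableSet_sideHit (d : ℤ) {C : Set (ℕ → ℤ)} (hC : MeasurableSet C) :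
    MeasurableSet (sideHit d C) := by
  have : sideHit d C = ⋃ z : ℤ, (ini {z} ∩ hit (side d z) C) := by
    ext ω; simp [sideHit, ini]
  rw [this]
  exact MeasurableSet.iUnion fun z => (measurableSet_ini _).inter (measurableSet_hit _ hC)

section
variable {K : ℤ → PMF ℤ} {P : ℤ → Measure (ℕ → ℤ)}

lemma P_sideHit (hprob : ∀ x, IsProbabilityMeasure (P x)) (hcyl : Cyl K P) (d x : ℤ)
    (C : Set (ℕ → ℤ)) : P x (sideHit d C) = P x (hit (side d x) C) := by
  apply measure_congr
  filter_upwards [ae_ini hprob hcyl x] with ω hω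
  apply propext
  change ω ∈ hit (side d (ω 0)) C ↔ ω ∈ hit (side d x) C
  rw [hω]

lemma P_hit_ini (hprob : ∀ x, IsProbabilityMeasure (P x)) (hcyl : Cyl K P) (D A : Set ℤ) (x : ℤ) :
    P x (hit D (ini A)) = ∑' y, G P D x y * A.indicator 1 y := by
  rw [markov hprob hcyl D (measurableSet_ini A)]
  simp_rw [P_ini hprob hcyl]

/-- Exit from the membrane (identity outside). -/
noncomputable def kE (P : ℤ → Measure (ℕ → ℤ)) (d : ℤ) : ℤ → ℤ → ℝ≥0∞ := fun x z => G P (Mem d) x z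

/-- Exit from the own component. -/
noncomputable def kS (P : ℤ → Measure (ℕ → ℤ)) (d : ℤ) : ℤ → ℤ → ℝ≥0∞ := fun x z => G P (side d x) x z

lemma sandwich {μ : Measure (ℕ → ℤ)} [IsProbabilityMeasure μ] {N T U : Set (ℕ → ℤ)} (h1 : N ⊆ T)
    (h2 : T ∩ U ⊆ N) (hU : MeasurableSet U) (h3 : μ U = 1) : μ T = μ N := by
  apply measure_congr
  have : ∀ᵐ ω ∂μ, ω ∈ U := (prob_compl_eq_zero_iff hU).mpr h3
  filter_upwards [this] with ω hω
  apply propext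
  exact ⟨fun h => h2 ⟨h, hω⟩, fun h => h1 h⟩

lemma exit_law (hprob : ∀ x, IsProbabilityMeasure (P x)) (hcyl : Cyl K P) (d : ℤ) (hd : 0 ≤ d)
    (hE : ∀ x, ∑' y, kE P d x y = 1) (hS : ∀ x, ∑' y, kS P d x y = 1) (x : ℤ) (A : Set ℤ) :
    P x {ω | ω (crossTimes d 1 ω).1 ∈ A} = ∑' y, mm (kE P d) (kS P d) x y * A.indicator 1 y := by
  have hN : ∀ A : Set ℤ, P x (hit (Mem d) (sideHit d (ini A))) =
      ∑' y, mm (kE P d) (kS P d) x y * A.indicator 1 y := by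
    intro A
    rw [markov hprob hcyl _ (measurableSet_sideHit d (measurableSet_ini A))]
    simp_rw [P_sideHit hprob hcyl, P_hit_ini hprob hcyl]
    exact (mv_assoc _ _ _).symm
  have hct : ∀ (A : Set ℤ) ω, ω ∈ hit (Mem d) (sideHit d (ini A)) → ω (crossTimes d 1 ω).1 ∈ A := by
    intro A ω hω
    obtain ⟨n, h1, h2⟩ := Set.mem_iUnion.mp hω
    obtain ⟨m, h3, h4⟩ := Set.mem_iUnion.mp h2
    have h0 : sh n ω 0 = ω n := by simp [sh]
    rw [h0] at h3
    rw [ct_one hd h1 h3]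
    simpa [ini, sh] using h4
  rw [← hN A]
  refine sandwich (U := hit (Mem d) (sideHit d (ini Set.univ))) (fun ω hω => hct A ω hω) ?_
    (measurableSet_hit _ (measurableSet_sideHit d (measurableSet_ini _))) ?_
  · rintro ω ⟨hT, hω⟩
    obtain ⟨n, h1, h2⟩ := Set.mem_iUnion.mp hω
    obtain ⟨m, h3, h4⟩ := Set.mem_iUnion.mp h2
    refine Set.mem_iUnion.mpr ⟨n, h1, Set.mem_iUnion.mpr ⟨m, h3, ?_⟩⟩
    have h0 : sh n ω 0 = ω n := by simp [sh]
    rw [h0] at h3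
    have hT' : ω (crossTimes d 1 ω).1 ∈ A := hT
    rw [ct_one hd h1 h3] at hT'
    simpa [ini, sh] using hT'
  · rw [hN]
    simpa using mm_sum _ _ hE hS x

lemma entrance_law (hprob : ∀ x, IsProbabilityMeasure (P x)) (hcyl : Cyl K P) (d : ℤ) (hd : 0 ≤ d)
    (hE : ∀ x, ∑' y, kE P d x y = 1) (hS : ∀ x, ∑' y, kS P d x y = 1) (x : ℤ) (hx : d < |x|)
    (A : Set ℤ) :
    P x {ω | ω (crossTimes d 1 ω).2 ∈ A} = ∑' y, mm (kS P d) (kE P d) x y * A.indicator 1 y := by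
  have hN : ∀ A : Set ℤ, P x (ini {x} ∩ sideHit d (hit (Mem d) (ini A))) =
      ∑' y, mm (kS P d) (kE P d) x y * A.indicator 1 y := by
    intro A
    have : P x (ini {x} ∩ sideHit d (hit (Mem d) (ini A))) = P x (sideHit d (hit (Mem d) (ini A))) := by
      apply measure_congr
      filter_upwards [ae_ini hprob hcyl x] with ω hω
      apply propext
      exact ⟨fun h => h.2, fun h => ⟨hω, h⟩⟩
    rw [this, P_sideHit hprob hcyl, markov hprob hcyl _ (measurableSet_hit _ (measurableSet_ini A))]
    simp_rw [P_hit_ini hprob hcyl]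
    exact (mv_assoc _ _ _).symm
  have h00 : ∀ ω, ω ∈ ini {x} → FE (Mem d) 0 ω := by
    intro ω hω
    refine ⟨fun k hk => absurd hk (Nat.not_lt_zero k), ?_⟩
    have : ω 0 = x := hω
    rw [this]
    exact not_le.mpr hx
  rw [← hN A]
  refine sandwich (U := ini {x} ∩ sideHit d (hit (Mem d) (ini Set.univ))) ?_ ?_
    ((measurableSet_ini _).inter
      (measurableSet_sideHit d (measurableSet_hit _ (measurableSet_ini _)))) ?_
  · rintro ω ⟨h0, hω⟩
    obtain ⟨m, h3, h4⟩ := Set.mem_iUnion.mp hω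
    obtain ⟨l, h5, h6⟩ := Set.mem_iUnion.mp h4
    change ω (crossTimes d 1 ω).2 ∈ A
    rw [ct_two hd (h00 ω h0) h3 h5]
    simpa [ini, sh] using h6
  · rintro ω ⟨hT, h0, hω⟩
    obtain ⟨m, h3, h4⟩ := Set.mem_iUnion.mp hω
    obtain ⟨l, h5, h6⟩ := Set.mem_iUnion.mp h4
    refine ⟨h0, Set.mem_iUnion.mpr ⟨m, h3, Set.mem_iUnion.mpr ⟨l, h5, ?_⟩⟩⟩
    have hT' : ω (crossTimes d 1 ω).2 ∈ A := hT
    rw [ct_two hd (h00 ω h0) h3 h5] at hT'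
    simpa [ini, sh] using hT'
  · rw [hN]
    simpa using mm_sum _ _ hS hE x

lemma kE_sum (hprob : ∀ x, IsProbabilityMeasure (P x)) (hcyl : Cyl K P) (d : ℤ)
    (hB2 : ∀ x : ℤ, |x| ≤ d → P x {ω | ∃ k, d < |ω k|} = 1) (x : ℤ) : ∑' y, kE P d x y = 1 := by
  by_cases hx : |x| ≤ d
  · simp only [kE]
    rw [G_tsum hprob hcyl, ← hB2 x hx]
    congr 1
    ext ω
    constructor
    · intro hω
      obtain ⟨n, h1, -⟩ := Set.mem_iUnion.mp hω
      exact ⟨n, not_le.mp h1.2⟩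
    · intro hω
      have hω' : ∃ k, d < |ω k| := hω
      classical
      refine Set.mem_iUnion.mpr ⟨Nat.find hω', ⟨fun k hk => ?_, ?_⟩, trivial⟩
      · exact not_lt.mp (Nat.find_min hω' hk)
      · exact not_le.mpr (Nat.find_spec hω')
  · have hx' : x ∉ Mem d := hx
    simp [kE, G_out hprob hcyl hx']

lemma kE_V (hprob : ∀ x, IsProbabilityMeasure (P x)) (hcyl : Cyl K P) (d : ℤ)
    (hB3 : ∀ x : ℤ, |x| ≤ d →
      ∫⁻ ω, ((ω (crossTimes d 0 ω).2).natAbs : ℝ≥0∞) ∂(P x) ≠ ⊤) :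
    ∃ B : ℝ≥0∞, B ≠ ⊤ ∧ (∀ x : ℤ, |x| ≤ d → ∑' y : ℤ, kE P d x y * (y.natAbs : ℝ≥0∞) ≤ B) ∧
      ∀ x : ℤ, ∑' y : ℤ, kE P d x y * (y.natAbs : ℝ≥0∞) ≤ (x.natAbs : ℝ≥0∞) + B := by
  have h1 : ∀ x : ℤ, |x| ≤ d → ∑' y : ℤ, kE P d x y * (y.natAbs : ℝ≥0∞) ≠ ⊤ := by
    intro x hx
    refine ne_top_of_le_ne_top (hB3 x hx) ?_
    calc ∑' y : ℤ, kE P d x y * (y.natAbs : ℝ≥0∞)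
        = ∑' y : ℤ, ∫⁻ ω, (hit (Mem d) (ini {y})).indicator (fun _ => (y.natAbs : ℝ≥0∞)) ω ∂(P x) := by
          refine tsum_congr fun y => ?_
          rw [lintegral_indicator_const (measurableSet_hit _ (measurableSet_ini _)), mul_comm]
          rfl
      _ = ∫⁻ ω, ∑' y : ℤ, (hit (Mem d) (ini {y})).indicator (fun _ => (y.natAbs : ℝ≥0∞)) ω ∂(P x) := by
          rw [lintegral_tsum]
          intro y
          exact (measurable_const.indicator (measurableSet_hit _ (measurableSet_ini _))).aemeasurable
      _ ≤ _ := by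
          refine lintegral_mono fun ω => ?_
          calc _ ≤ ∑' y : ℤ, if y = ω (crossTimes d 0 ω).2 then (y.natAbs : ℝ≥0∞) else 0 := by
                refine ENNReal.tsum_le_tsum fun y => ?_
                by_cases hω : ω ∈ hit (Mem d) (ini {y})
                · obtain ⟨n, h1, h2⟩ := Set.mem_iUnion.mp hω
                  have h3 : ω n = y := by simpa [ini, sh] using h2
                  rw [ct_zero h1, if_pos h3.symm, Set.indicator_of_mem hω]
                · rw [Set.indicator_of_notMem hω]; exact zero_le
            _ = _ := by rw [tsum_ite_eq]
  set B : ℝ≥0∞ := ∑ z ∈ Finset.Icc (-d) d, ∑' y : ℤ, kE P d z y * (y.natAbs : ℝ≥0∞) with hB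
  have h2 : ∀ x : ℤ, |x| ≤ d → ∑' y : ℤ, kE P d x y * (y.natAbs : ℝ≥0∞) ≤ B := by
    intro x hx
    exact Finset.single_le_sum (f := fun z => ∑' y : ℤ, kE P d z y * (y.natAbs : ℝ≥0∞))
      (fun _ _ => zero_le) (Finset.mem_Icc.mpr (abs_le.mp hx))
  refine ⟨B, ?_, h2, ?_⟩
  · refine ENNReal.sum_ne_top.mpr fun z hz => h1 z ?_
    exact abs_le.mpr (Finset.mem_Icc.mp hz)
  · intro x
    by_cases hx : |x| ≤ d
    · exact (h2 x hx).trans le_add_self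
    · have hx' : x ∉ Mem d := hx
      refine le_trans ?_ le_self_add
      simp [kE, G_out hprob hcyl hx']

/-- Irreducibility. -/
lemma irred (hprob : ∀ x, IsProbabilityMeasure (P x)) (hcyl : Cyl K P) (d : ℤ) (hd : 0 ≤ d)
    (hB4 : ∀ x y : ℤ, d < |x| → d < |y| → ∃ n : ℕ, iterK K n x y ≠ 0) (y₀ z : ℤ) (hy₀ : d < |y₀|)
    (hz : mm (kS P d) (kE P d) y₀ z ≠ 0)
    (μ : ℤ → ℝ≥0∞) (hμ : ∀ y, ∑' x, μ x * mm (kS P d) (kE P d) x y = μ y)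
    (hx : ∃ x, μ x ≠ 0) : μ z ≠ 0 := by
  obtain ⟨x, hx⟩ := hx
  set Q := mm (kS P d) (kE P d) with hQ
  have hμQ : ∀ x y, μ x * Q x y ≤ μ y := by
    intro x y
    rw [← hμ y]
    exact ENNReal.le_tsum (f := fun x => μ x * Q x y) x
  have hxO : d < |x| := by
    by_contra hcon
    have hxM : x ∈ Mem d := not_lt.mp hcon
    apply hx
    rw [← hμ x]
    simp [hQ, mm, kE, G_mem hxM]
  have claim : ∀ n w, iterK K n x w ≠ 0 → ∃ c : ℝ≥0∞, c ≠ 0 ∧ ∀ y, c * Q w y ≤ μ y := by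
    intro n
    induction n with
    | zero =>
      intro w hw
      have : w = x := by
        by_contra hne
        simp [iterK, hne] at hw
      subst this
      exact ⟨μ w, hx, hμQ w⟩
    | succ n ih =>
      intro w' hw'
      simp only [iterK, PMF.bind_apply] at hw'
      obtain ⟨w, hw⟩ : ∃ w, iterK K n x w * K w w' ≠ 0 := by
        by_contra hcon
        push Not at hcon
        exact hw' (by simp [hcon])
      obtain ⟨hw1, hw2⟩ := mul_ne_zero_iff.mp hw
      obtain ⟨c, hc, hcQ⟩ := ih w hw1
      have hSstep : ∀ z, K w w' * G P (side d w) w' z ≤ kS P d w z := by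
        intro z
        simp only [kS]
        rw [G_in hprob hcyl (mem_side d w) z]
        exact ENNReal.le_tsum (f := fun v => K w v * G P (side d w) v z) w'
      by_cases hside : w' ∈ side d w
      · refine ⟨c * K w w', mul_ne_zero hc hw2, fun y => le_trans ?_ (hcQ y)⟩
        rw [mul_assoc]
        gcongr
        simp only [hQ, mm]
        rw [← ENNReal.tsum_mul_left]
        refine ENNReal.tsum_le_tsum fun z => ?_
        rw [← mul_assoc]
        gcongr
        have := hSstep z
        rwa [← side_eq hd hside] at this
      · have hS' : K w w' ≤ kS P d w w' := by
          have := hSstep w'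
          rw [G_out hprob hcyl hside] at this
          simpa using this
        have hQE : ∀ y, K w w' * kE P d w' y ≤ Q w y := by
          intro y
          refine le_trans ?_ (ENNReal.le_tsum (f := fun z => kS P d w z * kE P d z y) w')
          exact mul_le_mul_left hS' _
        by_cases hM : |w'| ≤ d
        · refine ⟨c * K w w', mul_ne_zero hc hw2, fun y => le_trans ?_ (hcQ y)⟩
          rw [mul_assoc]
          gcongr
          refine le_trans ?_ (hQE y)
          gcongr
          have hle : ∀ z, kS P d w' z * kE P d z y ≤ if z = y then kE P d w' z else 0 := by
            intro z
            simp only [kS, side_mem hM, kE]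
            by_cases hzM : z ∈ Mem d
            · rw [G_mem hzM]; simp
            · rw [G_out hprob hcyl hzM]
              by_cases h : y = z
              · simp [h]
              · simp [h]
          refine (ENNReal.tsum_le_tsum hle).trans ?_
          rw [tsum_ite_eq]
        · have hM' : w' ∉ Mem d := hM
          refine ⟨μ w', ?_, hμQ w'⟩
          have h1 := hQE w'
          simp only [kE, G_out hprob hcyl hM', if_true, mul_one] at h1
          have h2 := hcQ w'
          have h3 : c * K w w' ≤ μ w' := (mul_le_mul_right h1 c).trans h2
          exact fun h0 => mul_ne_zero hc hw2 (le_zero_iff.mp (h0 ▸ h3))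
  obtain ⟨n, hn⟩ := hB4 x y₀ hxO hy₀
  obtain ⟨c, hc, hcQ⟩ := claim n y₀ hn
  exact fun h0 => mul_ne_zero hc hz (le_zero_iff.mp (h0 ▸ hcQ z))

end

end Membrane

/-- The embedded exit and entrance chains of a random walk on `ℤ` perturbed
on the membrane `{−d, …, d}` have unique stationary distributions, and these
stationary distributions are integrable. -/
theorem stmt_11 (d : ℤ) (hd : 0 ≤ d)
    (K : ℤ → PMF ℤ) (P : ℤ → Measure (ℕ → ℤ))
    (hprob : ∀ x, IsProbabilityMeasure (P x))
    (hcyl : ∀ (x : ℤ) (n : ℕ) (path : ℕ → ℤ),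
      P x {ω | ∀ k ≤ n, ω k = path k} =
        (if path 0 = x then 1 else 0) *
          ∏ k ∈ Finset.range n, K (path k) (path (k + 1)))
    -- (B1)
    (ξp ξm : PMF ℤ)
    (hB1p : ∀ x : ℤ, d < x → ∀ y : ℤ, K x (x + y) = ξp y)
    (hB1m : ∀ x : ℤ, x < -d → ∀ y : ℤ, K x (x + y) = ξm y)
    (hintp : Summable fun y : ℤ => |(y : ℝ)| * (ξp y).toReal)
    (hintm : Summable fun y : ℤ => |(y : ℝ)| * (ξm y).toReal)
    (hmeanp : ∑' y : ℤ, (y : ℝ) * (ξp y).toReal = 0)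
    (hmeanm : ∑' y : ℤ, (y : ℝ) * (ξm y).toReal = 0)
    (hsqp : Summable fun y : ℤ => (y : ℝ) ^ 2 * (ξp y).toReal)
    (hsqm : Summable fun y : ℤ => (y : ℝ) ^ 2 * (ξm y).toReal)
    (hvarp : 0 < ∑' y : ℤ, (y : ℝ) ^ 2 * (ξp y).toReal)
    (hvarm : 0 < ∑' y : ℤ, (y : ℝ) ^ 2 * (ξm y).toReal)
    (harithp : ∀ n : ℕ, 1 ≤ n → (∀ y : ℤ, ξp y ≠ 0 → (n : ℤ) ∣ y) → n = 1)
    (harithm : ∀ n : ℕ, 1 ≤ n → (∀ y : ℤ, ξm y ≠ 0 → (n : ℤ) ∣ y) → n = 1)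
    -- (B2)
    (hB2 : ∀ x : ℤ, |x| ≤ d → P x {ω | ∃ k, d < |ω k|} = 1)
    -- (B3)
    (hB3 : ∀ x : ℤ, |x| ≤ d →
      ∫⁻ ω, ((ω (crossTimes d 0 ω).2).natAbs : ℝ≥0∞) ∂(P x) ≠ ⊤)
    -- (B4): the states `ℤ ∖ {−d, …, d}` communicate
    (hB4 : ∀ x y : ℤ, d < |x| → d < |y| → ∃ n : ℕ, iterK K n x y ≠ 0) :
    (∃! π : Measure ℤ, ExitStationary d P π) ∧
    (∃! π : Measure ℤ, EntranceStationary d P π) ∧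
    (∀ π : Measure ℤ, ExitStationary d P π →
      ∑' x : ℤ, (x.natAbs : ℝ≥0∞) * π {x} ≠ ⊤) ∧
    (∀ π : Measure ℤ, EntranceStationary d P π →
      ∑' x : ℤ, (x.natAbs : ℝ≥0∞) * π {x} ≠ ⊤) := by
  have hcyl' : Membrane.Cyl K P := hcyl
  have hE := Membrane.kE_sum hprob hcyl' d hB2
  obtain ⟨B, hBt, hB1, hB⟩ := Membrane.kE_V hprob hcyl' d hB3
  have hpmf : ∀ p : PMF ℤ, HasSum (fun y => (p y).toReal) 1 := by
    intro p
    have := Membrane.hasSum_toReal_tsum (fun w => p w) (by rw [p.tsum_coe]; simp)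
    rwa [p.tsum_coe, ENNReal.toReal_one] at this
  obtain ⟨Cp, hCp, hp⟩ := Membrane.side_walk hprob hcyl' d hd 1 (Or.inl rfl)
    (fun y => (ξp y).toReal) (fun _ => ENNReal.toReal_nonneg) (hpmf ξp)
    (fun x hx y => by rw [one_mul, hB1p x (by simpa using hx)]) hintp hmeanp hsqp hvarp
  obtain ⟨Cm, hCm, hm⟩ := Membrane.side_walk hprob hcyl' d hd (-1) (Or.inr rfl)
    (fun y => (ξm (-y)).toReal) (fun _ => ENNReal.toReal_nonneg)
    ((Equiv.neg ℤ).hasSum_iff.mpr (hpmf ξm))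
    (fun x hx y => by rw [neg_one_mul, hB1m x (by omega)])
    (by
      have := (Equiv.neg ℤ).summable_iff.mpr hintm
      refine this.congr fun y => ?_
      simp)
    (by
      have := (Equiv.neg ℤ).tsum_eq (fun y : ℤ => (y : ℝ) * (ξm y).toReal)
      rw [hmeanm] at this
      rw [← neg_eq_zero, ← tsum_neg, ← this]
      refine tsum_congr fun y => ?_
      simp)
    (by
      have := (Equiv.neg ℤ).summable_iff.mpr hsqm
      refine this.congr fun y => ?_
      simp)
    (by
      have := (Equiv.neg ℤ).tsum_eq (fun y : ℤ => (y : ℝ) ^ 2 * (ξm y).toReal)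
      rw [← this] at hvarm
      refine lt_of_lt_of_eq hvarm (tsum_congr fun y => ?_)
      simp)
  have hSS : ∀ x : ℤ, ∑' y, Membrane.kS P d x y = 1 ∧
      ∑' y : ℤ, Membrane.kS P d x y * (y.natAbs : ℝ≥0∞) ≤
        2⁻¹ * (x.natAbs : ℝ≥0∞) + (Cp + Cm + B) := by
    intro x
    by_cases h1 : d < x
    · have hs : Membrane.side d x = {y | d < 1 * y} := by
        unfold Membrane.side; rw [if_pos h1]
      obtain ⟨h3, h4⟩ := hp x (by simpa using h1)
      unfold Membrane.kS
      rw [hs]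
      refine ⟨h3, h4.trans ?_⟩
      gcongr
      rw [add_assoc]; exact le_self_add
    · by_cases h2 : x < -d
      · have hs : Membrane.side d x = {y | d < (-1) * y} := by
          unfold Membrane.side; rw [if_neg h1, if_pos h2]
        obtain ⟨h3, h4⟩ := hm x (by omega)
        unfold Membrane.kS
        rw [hs]
        refine ⟨h3, h4.trans ?_⟩
        gcongr
        exact le_add_self.trans le_self_add
      · have hx : |x| ≤ d := by rw [abs_le]; omega
        have h3 := hE x
        have h4 := hB1 x hx
        unfold Membrane.kS
        rw [Membrane.side_mem hx]
        exact ⟨h3, h4.trans (le_add_self.trans le_add_self)⟩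
  have hS := fun x => (hSS x).1
  set E := Membrane.kE P d with hEdef
  set S := Membrane.kS P d with hSdef
  set Cs := Cp + Cm + B with hCs
  have hCst : Cs ≠ ⊤ := by simp [hCs, hCp, hCm, hBt]
  have hQ : ∀ x, ∑' y, Membrane.mm S E x y = 1 := Membrane.mm_sum S E hS hE
  have hdrift : ∀ x : ℤ, ∑' y : ℤ, Membrane.mm S E x y * (y.natAbs : ℝ≥0∞) ≤
      2⁻¹ * (x.natAbs : ℝ≥0∞) + (Cs + B) := by
    intro x
    have h1 := Membrane.mv_assoc (S x) E (fun y => (y.natAbs : ℝ≥0∞))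
    calc _ = ∑' z, S x z * ∑' y : ℤ, E z y * (y.natAbs : ℝ≥0∞) := h1
      _ ≤ ∑' z : ℤ, S x z * ((z.natAbs : ℝ≥0∞) + B) :=
        ENNReal.tsum_le_tsum fun z => mul_le_mul_right (hB z) _
      _ = ∑' z : ℤ, S x z * (z.natAbs : ℝ≥0∞) + B := by
        simp_rw [mul_add]
        rw [ENNReal.tsum_add, ENNReal.tsum_mul_right, hS, one_mul]
      _ ≤ _ := by
        rw [← add_assoc]
        exact add_le_add_left (hSS x).2 _
  obtain ⟨ν, hν1, hνi, hνV⟩ := Membrane.exists_inv (Membrane.mm S E) hQ (Cs + B)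
    (by simp [hCst, hBt]) hdrift
  have hy0 : d < |d + 1| := by rw [abs_of_nonneg (by omega)]; omega
  obtain ⟨z₀, hz₀⟩ : ∃ z, Membrane.mm S E (d + 1) z ≠ 0 := by
    by_contra! h
    have := hQ (d + 1)
    simp [h] at this
  have huniq : ∀ p : ℤ → ℝ≥0∞, ∑' x, p x = 1 → Membrane.vm p (Membrane.mm S E) = p → p = ν := by
    intro p hp1 hpi
    exact Membrane.unique_inv (Membrane.mm S E) hQ z₀
      (fun μ _ hμ hx => Membrane.irred hprob hcyl' d hd hB4 (d + 1) z₀ hy0 hz₀ μ hμ hx)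
      p ν hp1 hν1 (fun y => congrFun hpi y) hνi
  have hνvm : Membrane.vm ν (Membrane.mm S E) = ν := funext hνi
  have hνmem : ∀ x, |x| ≤ d → ν x = 0 := by
    intro x hx
    rw [← hνi x]
    have : ∀ w, Membrane.mm S E w x = 0 := by
      intro w
      have h0 : ∀ z, E z x = 0 := fun z => Membrane.G_mem (show x ∈ Membrane.Mem d from hx) z
      simp [Membrane.mm, h0]
    simp [this]
  -- entrance chain
  have hent : ∀ π : Measure ℤ, (∀ x, |x| ≤ d → π {x} = 0) →
      ((∀ A : Set ℤ, ∑' x : ℤ, π {x} * P x {ω | ω (crossTimes d 1 ω).2 ∈ A} = π A) ↔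
        Membrane.vm (fun x => π {x}) (Membrane.mm S E) = fun y => π {y}) := by
    intro π h0
    refine Membrane.stat_conv π (fun x A => P x {ω | ω (crossTimes d 1 ω).2 ∈ A}) _ ?_
    intro x A
    by_cases hx : |x| ≤ d
    · simp [h0 x hx]
    · skip
      rw [Membrane.entrance_law hprob hcyl' d hd hE hS x (not_le.mp hx) A]
  have hentU : ∀ π : Measure ℤ, EntranceStationary d P π → ∀ x, π {x} = ν x := by
    rintro π ⟨hπ, hπ0, hπs⟩
    have h0 : ∀ x, |x| ≤ d → π {x} = 0 := fun x hx =>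
      measure_mono_null (Set.singleton_subset_iff.mpr hx) hπ0
    exact congrFun (huniq _ (Membrane.measure_sum_one π) ((hent π h0).mp hπs))
  -- exit chain
  have hex : ∀ π : Measure ℤ,
      ((∀ A : Set ℤ, ∑' x : ℤ, π {x} * P x {ω | ω (crossTimes d 1 ω).1 ∈ A} = π A) ↔
        Membrane.vm (fun x => π {x}) (Membrane.mm E S) = fun y => π {y}) := by
    intro π
    refine Membrane.stat_conv π (fun x A => P x {ω | ω (crossTimes d 1 ω).1 ∈ A}) _ ?_
    intro x A
    rw [Membrane.exit_law hprob hcyl' d hd hE hS x A]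
  have hexU : ∀ π : Measure ℤ, ExitStationary d P π → ∀ x, π {x} = Membrane.vm ν S x := by
    rintro π ⟨hπ, hπs⟩
    have h1 := (hex π).mp hπs
    have h2 : Membrane.vm (fun x => π {x}) E = ν := by
      apply huniq
      · rw [Membrane.vm_sum _ _ hE]; exact Membrane.measure_sum_one π
      · rw [Membrane.vm_mm, ← Membrane.vm_mm _ E S, h1]
    rw [Membrane.vm_mm, h2] at h1
    exact fun x => (congrFun h1 x).symm
  refine ⟨?_, ?_, ?_, ?_⟩
  · obtain ⟨π, hπ, hπν⟩ := Membrane.exists_measure (Membrane.vm ν S)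
      (by rw [Membrane.vm_sum _ _ hS, hν1])
    have hst : ExitStationary d P π := by
      refine ⟨hπ, (hex π).mpr ?_⟩
      have : (fun x => π {x}) = Membrane.vm ν S := funext hπν
      rw [this, Membrane.vm_mm, ← Membrane.vm_mm ν S E, hνvm]
    exact ⟨π, hst, fun ρ hρ => Membrane.measure_ext_singleton ρ π fun x => by
      rw [hexU ρ hρ x, hπν]⟩
  · obtain ⟨π, hπ, hπν⟩ := Membrane.exists_measure ν hν1
    have h0 : ∀ x, |x| ≤ d → π {x} = 0 := fun x hx => by rw [hπν, hνmem x hx]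
    have hst : EntranceStationary d P π := by
      refine ⟨hπ, ?_, (hent π h0).mpr ?_⟩
      · rw [← Membrane.measure_tsum π, ENNReal.tsum_eq_zero]
        intro x
        by_cases hx : |x| ≤ d
        · rw [h0 x hx, zero_mul]
        · simp [hx]
      · have : (fun x => π {x}) = ν := funext hπν
        rw [this, hνvm]
    exact ⟨π, hst, fun ρ hρ => Membrane.measure_ext_singleton ρ π fun x => by
      rw [hentU ρ hρ x, hπν]⟩
  · intro π hπ
    simp_rw [hexU π hπ, mul_comm]
    have h1 := Membrane.mv_assoc ν S (fun y => (y.natAbs : ℝ≥0∞))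
    have h2 : ∑' y : ℤ, Membrane.vm ν S y * (y.natAbs : ℝ≥0∞) ≤
        2⁻¹ * (∑' x : ℤ, ν x * (x.natAbs : ℝ≥0∞)) + Cs := by
      calc _ = ∑' x, ν x * ∑' y : ℤ, S x y * (y.natAbs : ℝ≥0∞) := h1
        _ ≤ ∑' x : ℤ, ν x * (2⁻¹ * (x.natAbs : ℝ≥0∞) + Cs) :=
          ENNReal.tsum_le_tsum fun z => mul_le_mul_right (hSS z).2 _
        _ = _ := by
          simp_rw [mul_add]
          rw [ENNReal.tsum_add, ENNReal.tsum_mul_right, hν1, one_mul, ← ENNReal.tsum_mul_left]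
          simp_rw [mul_left_comm]
    refine ne_top_of_le_ne_top ?_ h2
    exact ENNReal.add_ne_top.mpr ⟨ENNReal.mul_ne_top (by simp) hνV, hCst⟩
  · intro π hπ
    simp_rw [hentU π hπ, mul_comm]
    exact hνV
end

section
/- Let φ(x) := x·(v₊^{−1} 1_{x≥0} + v₋^{−1} 1_{x<0}), and for x ≠ 0 write v_{sgn x} := v₊ if x > 0 and v₋ if x < 0. Define γ := E_{π_entrance}[φ(X(0) − X(σ̃₁))] / E_{π_entrance}[|φ(X(0) − X(σ̃₁))|]. Then γ = E_{π_entrance}[(X(0) − X(σ̃₁)) v^{−1}_{sgn(X(0)−X(σ̃₁))}] / E_{π_entrance}[|X(0) − X(σ̃₁)| v^{−1}_{sgn(X(0)−X(σ̃₁))}] = E_{π_entrance}[(X(0) − X(σ̃₁)) v^{−1}_{sgn X(0)}] / E_{π_entrance}[|X(0) − X(σ̃₁)| v^{−1}_{sgn X(0)}], and γ ∈ (−1, 1). -/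
open MeasureTheory Filter
open scoped ENNReal

/-- `φ(x) = x (v₊⁻¹ 1_{x ≥ 0} + v₋⁻¹ 1_{x < 0})`. -/
noncomputable def phi (vp vm : ℝ) (t : ℝ) : ℝ := if 0 ≤ t then t / vp else t / vm

/-- `v_{sgn x}`: `v₊` if `x > 0` and `v₋` if `x < 0` (the value at `x = 0` is
irrelevant since it is always multiplied by `0`). -/
noncomputable def vsgn (vp vm : ℝ) (z : ℤ) : ℝ := if z < 0 then vm else vp


/-- Path extraction from the iterated kernel. -/
lemma iterK_path (K : ℤ → PMF ℤ) (n : ℕ) : ∀ (x y : ℤ), iterK K n x y ≠ 0 →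
    ∃ p : ℕ → ℤ, p 0 = x ∧ p n = y ∧ ∀ k < n, K (p k) (p (k + 1)) ≠ 0 := by
  induction n with
  | zero =>
    intro x y h
    refine ⟨fun _ => x, rfl, ?_, by simp⟩
    by_contra hne
    apply h
    simp only [iterK, PMF.pure_apply]
    rw [if_neg]
    exact fun h' => hne h'.symm
  | succ n ih =>
    intro x y h
    have h' : y ∈ ((iterK K n x).bind K).support := h
    rw [PMF.mem_support_bind_iff] at h'
    obtain ⟨z, hz, hy⟩ := h'
    obtain ⟨p, h0, hn, hk⟩ := ih x z hz
    refine ⟨fun k => if k ≤ n then p k else y, by simpa using h0, by simp, ?_⟩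
    intro k hkn
    have hkn' : k ≤ n := by omega
    by_cases hkl : k < n
    · simp only [hkn', if_true, if_pos (show k + 1 ≤ n by omega)]
      exact hk k hkl
    · have : k = n := by omega
      subst this
      simp only [le_refl, if_true, if_neg (show ¬ (k + 1 ≤ k) by omega), hn]
      exact hy

/-- One of the two outer half-lines. -/
def IsSide (d : ℤ) (S : Set ℤ) : Prop := S = {z | d < z} ∨ S = {z | z < -d}

lemma cross_zero (d : ℤ) (ω : ℕ → ℤ) (h0 : d < |ω 0|) : (crossTimes d 0 ω).2 = 0 := by
  simp only [crossTimes]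
  exact Nat.sInf_eq_zero.mpr (Or.inl h0)

lemma side_abs {d : ℤ} (hd : 0 ≤ d) {S : Set ℤ} (hS : IsSide d S) {z : ℤ} (hz : z ∈ S) :
    d < |z| := by
  rcases hS with rfl | rfl
  · exact lt_of_lt_of_le hz (le_abs_self z)
  · have : z < -d := hz
    have := neg_le_abs z
    omega

lemma cross_one_exit {d : ℤ} (hd : 0 ≤ d) {S : Set ℤ} (hS : IsSide d S) (ω : ℕ → ℤ) (n : ℕ)
    (hin : ∀ k ≤ n, ω k ∈ S) (hout : ω (n + 1) ∉ S) : (crossTimes d 1 ω).1 = n + 1 := by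
  have h0 := cross_zero d ω (side_abs hd hS (hin 0 (Nat.zero_le _)))
  simp only [crossTimes] at h0 ⊢
  rw [h0]
  apply le_antisymm
  · apply Nat.sInf_le
    refine ⟨Nat.succ_pos _, ?_⟩
    have h1 := hin n le_rfl
    rcases hS with rfl | rfl
    · left
      simpa using And.intro h1 hout
    · right
      simpa using And.intro h1 hout
  · apply le_csInf
    · refine ⟨n + 1, Nat.succ_pos _, ?_⟩
      have h1 := hin n le_rfl
      rcases hS with rfl | rfl
      · left
        simpa using And.intro h1 hout
      · right
        simpa using And.intro h1 hout
    · rintro k ⟨hk0, hk⟩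
      by_contra hlt
      have h1 := hin k (by omega)
      have h2 := hin (k - 1) (by omega)
      rcases hS with rfl | rfl
      · simp only [Set.mem_ofPred_eq] at h1 h2
        omega
      · simp only [Set.mem_ofPred_eq] at h1 h2
        omega

lemma cross_one_stay {d : ℤ} (hd : 0 ≤ d) {S : Set ℤ} (hS : IsSide d S) (ω : ℕ → ℤ)
    (hin : ∀ k, ω k ∈ S) : (crossTimes d 1 ω).1 = 0 := by
  have h0 := cross_zero d ω (side_abs hd hS (hin 0))
  simp only [crossTimes] at h0 ⊢
  rw [h0]
  apply Nat.sInf_eq_zero.mpr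
  right
  rw [Set.eq_empty_iff_forall_notMem]
  rintro k ⟨hk0, hk⟩
  have h1 := hin k
  have h2 := hin (k - 1)
  rcases hS with rfl | rfl
  · simp only [Set.mem_ofPred_eq] at h1 h2
    omega
  · simp only [Set.mem_ofPred_eq] at h1 h2
    omega

/-- first exit -/
lemma first_exit {S : Set ℤ} (p : ℕ → ℤ) (n : ℕ) (h0 : p 0 ∈ S) (hn : p n ∉ S) :
    ∃ k, k + 1 ≤ n ∧ (∀ j ≤ k, p j ∈ S) ∧ p (k + 1) ∉ S := by
  classical
  have hex : ∃ m, p m ∉ S := ⟨n, hn⟩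
  have hm := Nat.find_spec hex
  have hle := Nat.find_min' hex hn
  have hmin : ∀ j < Nat.find hex, p j ∈ S := fun j hj => not_not.mp (Nat.find_min hex hj)
  generalize Nat.find hex = m at hm hle hmin
  cases m with
  | zero => exact absurd h0 hm
  | succ k => exact ⟨k, hle, fun j hj => hmin j (by omega), hm⟩

lemma exit_or_stay {S : Set ℤ} (ω : ℕ → ℤ) (h0 : ω 0 ∈ S) :
    (∀ k, ω k ∈ S) ∨ ∃ n, (∀ k ≤ n, ω k ∈ S) ∧ ω (n + 1) ∉ S := by
  by_cases h : ∀ k, ω k ∈ S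
  · exact Or.inl h
  · push Not at h
    obtain ⟨m, hm⟩ := h
    obtain ⟨k, -, h1, h2⟩ := first_exit ω m h0 hm
    exact Or.inr ⟨k, h1, h2⟩

lemma cyl_pos {K : ℤ → PMF ℤ} {P : ℤ → Measure (ℕ → ℤ)}
    (hcyl : ∀ (x : ℤ) (n : ℕ) (path : ℕ → ℤ),
      P x {ω | ∀ k ≤ n, ω k = path k} =
        (if path 0 = x then 1 else 0) *
          ∏ k ∈ Finset.range n, K (path k) (path (k + 1)))
    (p : ℕ → ℤ) (n : ℕ) (hp : ∀ k < n, K (p k) (p (k + 1)) ≠ 0) :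
    P (p 0) {ω | ∀ k ≤ n, ω k = p k} ≠ 0 := by
  rw [hcyl, if_pos rfl, one_mul]
  exact Finset.prod_ne_zero_iff.mpr fun k hk => hp k (Finset.mem_range.mp hk)

lemma start_ae {K : ℤ → PMF ℤ} {P : ℤ → Measure (ℕ → ℤ)}
    (hprob : ∀ x, IsProbabilityMeasure (P x))
    (hcyl : ∀ (x : ℤ) (n : ℕ) (path : ℕ → ℤ),
      P x {ω | ∀ k ≤ n, ω k = path k} =
        (if path 0 = x then 1 else 0) *
          ∏ k ∈ Finset.range n, K (path k) (path (k + 1)))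
    (x : ℤ) : ∀ᵐ ω ∂(P x), ω 0 = x := by
  have h := hcyl x 0 (fun _ => x)
  simp at h
  have hm : MeasurableSet {ω : ℕ → ℤ | ω 0 = x} :=
    measurableSet_eq_fun (measurable_pi_apply 0) measurable_const
  have := hprob x
  exact (mem_ae_iff_prob_eq_one hm).mpr h

lemma support_step {d : ℤ} {K : ℤ → PMF ℤ} {P : ℤ → Measure (ℕ → ℤ)} (hd : 0 ≤ d)
    (hcyl : ∀ (x : ℤ) (n : ℕ) (path : ℕ → ℤ),
      P x {ω | ∀ k ≤ n, ω k = path k} =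
        (if path 0 = x then 1 else 0) *
          ∏ k ∈ Finset.range n, K (path k) (path (k + 1)))
    {πent : Measure ℤ} (hπ : EntranceStationary d P πent)
    {S S' : Set ℤ} (hS : IsSide d S) (hS' : IsSide d S')
    (hdisj : ∀ z, d < |z| → z ∈ S ∨ z ∈ S') (hd2 : ∀ z ∈ S, z ∉ S')
    (n : ℕ) : ∀ (p : ℕ → ℤ), πent {p 0} ≠ 0 → (∀ k < n, K (p k) (p (k + 1)) ≠ 0) → p n ∈ S →
      ∃ z ∈ S, πent {z} ≠ 0 := by
  classical
  induction n using Nat.strong_induction_on with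
  | _ n ih =>
  intro p h0 hp hn
  obtain ⟨_, hπ0, hst⟩ := hπ
  have habs : d < |p 0| := by
    by_contra hle
    apply h0
    refine measure_mono_null ?_ hπ0
    intro y hy
    rw [Set.mem_singleton_iff] at hy
    subst hy
    exact not_lt.mp hle
  rcases hdisj _ habs with h | h
  · exact ⟨_, h, h0⟩
  obtain ⟨k, hkn, hin, hout⟩ := first_exit p n h (hd2 _ hn)
  have hex : ∃ m, k + 1 ≤ m ∧ d < |p m| := ⟨n, hkn, side_abs hd hS hn⟩
  obtain ⟨hm1, hm2⟩ := Nat.find_spec hex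
  have hmn : Nat.find hex ≤ n := Nat.find_min' hex ⟨hkn, side_abs hd hS hn⟩
  have hmin : ∀ j < Nat.find hex, ¬ (k + 1 ≤ j ∧ d < |p j|) := fun j hj => Nat.find_min hex hj
  generalize Nat.find hex = m at hm1 hm2 hmn hmin
  have hpos := cyl_pos hcyl p m (fun j hj => hp j (by omega))
  have hsub : {ω : ℕ → ℤ | ∀ k ≤ m, ω k = p k} ⊆
      {ω | ω (crossTimes d 1 ω).2 ∈ ({p m} : Set ℤ)} := by
    intro ω hω
    have h1 : (crossTimes d 1 ω).1 = k + 1 := by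
      apply cross_one_exit hd hS' ω k
      · intro j hj
        rw [hω j (by omega)]
        exact hin j hj
      · rw [hω _ hm1]
        exact hout
    have h2 : (crossTimes d 1 ω).2 = m := by
      have : (crossTimes d 1 ω).2 = sInf {j : ℕ | (crossTimes d 1 ω).1 ≤ j ∧ d < |ω j|} := rfl
      rw [this, h1]
      apply le_antisymm
      · apply Nat.sInf_le
        refine ⟨hm1, ?_⟩
        rw [hω m le_rfl]
        exact hm2
      · apply le_csInf
        · refine ⟨m, hm1, ?_⟩
          rw [hω m le_rfl]
          exact hm2
        · rintro j ⟨hj1, hj2⟩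
          by_contra hlt
          rw [hω j (by omega)] at hj2
          exact hmin j (by omega) ⟨hj1, hj2⟩
    change ω (crossTimes d 1 ω).2 = p m
    rw [h2]
    exact hω m le_rfl
  have hπm : πent {p m} ≠ 0 := by
    rw [← hst {p m}]
    intro hz
    rw [ENNReal.tsum_eq_zero] at hz
    have := hz (p 0)
    rw [mul_eq_zero] at this
    rcases this with h | h
    · exact h0 h
    · exact hpos (measure_mono_null hsub h)
  refine ih (n - m) (by omega) (fun j => p (m + j)) (by simpa using hπm) ?_ ?_
  · intro j hj
    exact hp (m + j) (by omega)
  · have : m + (n - m) = n := by omega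
    simpa [this] using hn

/-- one-step Markov property -/
lemma one_step {K : ℤ → PMF ℤ} {P : ℤ → Measure (ℕ → ℤ)}
    (hcyl : ∀ (x : ℤ) (n : ℕ) (path : ℕ → ℤ),
      P x {ω | ∀ k ≤ n, ω k = path k} =
        (if path 0 = x then 1 else 0) *
          ∏ k ∈ Finset.range n, K (path k) (path (k + 1)))
    (x : ℤ) (n : ℕ) (S : Set ℤ) (z w : ℤ) :
    P x {ω | (∀ k ≤ n, ω k ∈ S) ∧ ω n = z ∧ ω (n + 1) = w} =
      P x {ω | (∀ k ≤ n, ω k ∈ S) ∧ ω n = z} * K z w := by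
  classical
  let ext : (Fin (n + 1) → ℤ) → ℕ → ℤ := fun p k => if h : k < n + 1 then p ⟨k, h⟩ else w
  let I := {p : Fin (n + 1) → ℤ // (∀ k ≤ n, ext p k ∈ S) ∧ ext p n = z}
  have hmeas : ∀ (m : ℕ) (p : ℕ → ℤ), MeasurableSet {ω : ℕ → ℤ | ∀ k ≤ m, ω k = p k} := by
    intro m p
    have : {ω : ℕ → ℤ | ∀ k ≤ m, ω k = p k} = ⋂ k, ⋂ (_ : k ≤ m), {ω | ω k = p k} := by
      ext ω; simp
    rw [this]
    exact MeasurableSet.iInter fun k => MeasurableSet.iInter fun _ =>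
      (measurable_pi_apply k) (measurableSet_singleton _)
  have hdis : ∀ (p q : I), p ≠ q → ∀ ω : ℕ → ℤ, (∀ k ≤ n, ω k = ext p.1 k) →
      (∀ k ≤ n, ω k = ext q.1 k) → False := by
    intro p q hpq ω h1 h2
    apply hpq
    apply Subtype.ext
    funext i
    have a := h1 i (by omega)
    have b := h2 i (by omega)
    simp only [ext, i.2, dif_pos] at a b
    rw [← a, ← b]
  have e1 : {ω : ℕ → ℤ | (∀ k ≤ n, ω k ∈ S) ∧ ω n = z} =
      ⋃ p : I, {ω | ∀ k ≤ n, ω k = ext p.1 k} := by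
    ext ω
    simp only [Set.mem_ofPred_eq, Set.mem_iUnion]
    constructor
    · rintro ⟨h1, h2⟩
      have hk : ∀ k ≤ n, ω k = ext (fun i => ω i) k := by
        intro k hk
        simp only [ext, dif_pos (Nat.lt_succ_of_le hk)]
      refine ⟨⟨fun i => ω i, ?_, ?_⟩, hk⟩
      · intro k hk'
        rw [← hk k hk']
        exact h1 k hk'
      · rw [← hk n le_rfl]
        exact h2
    · rintro ⟨⟨p, hp1, hp2⟩, h⟩
      refine ⟨fun k hk => ?_, ?_⟩
      · rw [h k hk]
        exact hp1 k hk
      · rw [h n le_rfl]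
        exact hp2
  have e2 : {ω : ℕ → ℤ | (∀ k ≤ n, ω k ∈ S) ∧ ω n = z ∧ ω (n + 1) = w} =
      ⋃ p : I, {ω | ∀ k ≤ n + 1, ω k = ext p.1 k} := by
    have : {ω : ℕ → ℤ | (∀ k ≤ n, ω k ∈ S) ∧ ω n = z ∧ ω (n + 1) = w} =
      {ω : ℕ → ℤ | (∀ k ≤ n, ω k ∈ S) ∧ ω n = z} ∩ {ω | ω (n + 1) = w} := by
      ext ω; simp [and_assoc]
    rw [this, e1, Set.iUnion_inter]
    congr 1
    funext p
    ext ω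
    simp only [Set.mem_inter_iff, Set.mem_ofPred_eq]
    have hw : ext p.1 (n + 1) = w := by simp [ext]
    constructor
    · rintro ⟨h1, h2⟩ k hk
      rcases Nat.lt_or_ge k (n + 1) with h | h
      · exact h1 k (by omega)
      · have : k = n + 1 := by omega
        subst this
        rw [h2, hw]
    · intro h
      exact ⟨fun k hk => h k (by omega), by rw [h _ le_rfl, hw]⟩
  rw [e1, e2, measure_iUnion, measure_iUnion, ← ENNReal.tsum_mul_right]
  · congr 1
    funext p
    rw [hcyl, hcyl, Finset.prod_range_succ, ← mul_assoc]
    have hw : ext p.1 (n + 1) = w := by simp [ext]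
    rw [hw, p.2.2]
  · intro p q hpq
    exact Set.disjoint_left.mpr fun ω h1 h2 => hdis p q hpq ω h1 h2
  · exact fun p => hmeas _ _
  · intro p q hpq
    exact Set.disjoint_left.mpr fun ω h1 h2 => hdis p q hpq ω
      (fun k hk => h1 k (by omega)) (fun k hk => h2 k (by omega))
  · exact fun p => hmeas _ _

lemma meas_stay (n : ℕ) (S : Set ℤ) : MeasurableSet {ω : ℕ → ℤ | ∀ k ≤ n, ω k ∈ S} := by
  have : {ω : ℕ → ℤ | ∀ k ≤ n, ω k ∈ S} = ⋂ k, ⋂ (_ : k ≤ n), {ω | ω k ∈ S} := by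
    ext ω; simp
  rw [this]
  exact MeasurableSet.iInter fun k => MeasurableSet.iInter fun _ =>
    (measurable_pi_apply k) (MeasurableSet.of_discrete (s := S))

lemma super_step {K : ℤ → PMF ℤ} {P : ℤ → Measure (ℕ → ℤ)}
    (hcyl : ∀ (x : ℤ) (n : ℕ) (path : ℕ → ℤ),
      P x {ω | ∀ k ≤ n, ω k = path k} =
        (if path 0 = x then 1 else 0) *
          ∏ k ∈ Finset.range n, K (path k) (path (k + 1)))
    (x : ℤ) (n : ℕ) (S : Set ℤ) (V : ℤ → ℝ≥0∞)
    (hV : ∀ z ∈ S, ∑' w, K z w * V w ≤ V z) :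
    ∫⁻ ω in {ω : ℕ → ℤ | ∀ k ≤ n, ω k ∈ S}, V (ω (n + 1)) ∂(P x) ≤
      ∫⁻ ω in {ω : ℕ → ℤ | ∀ k ≤ n, ω k ∈ S}, V (ω n) ∂(P x) := by
  set A := {ω : ℕ → ℤ | ∀ k ≤ n, ω k ∈ S} with hA
  have hm2 : Measurable fun ω : ℕ → ℤ => (ω n, ω (n + 1)) :=
    (measurable_pi_apply n).prodMk (measurable_pi_apply (n + 1))
  have l1 : ∫⁻ ω in A, V (ω (n + 1)) ∂(P x) =
      ∑' z : ℤ, ∑' w : ℤ, V w * (P x {ω | (∀ k ≤ n, ω k ∈ S) ∧ ω n = z ∧ ω (n + 1) = w}) := by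
    have : ∫⁻ ω in A, V (ω (n + 1)) ∂(P x) =
      ∫⁻ q : ℤ × ℤ, V q.2 ∂(((P x).restrict A).map fun ω => (ω n, ω (n + 1))) := by
      rw [lintegral_map (Measurable.of_discrete) hm2]
    rw [this, lintegral_countable', ENNReal.tsum_prod']
    congr 1; funext z; congr 1; funext w
    rw [Measure.map_apply hm2 (measurableSet_singleton _),
      Measure.restrict_apply (hm2 (measurableSet_singleton _))]
    congr 2
    ext ω
    simp [hA, and_comm]
  have l2 : ∫⁻ ω in A, V (ω n) ∂(P x) =
      ∑' z : ℤ, V z * (P x {ω | (∀ k ≤ n, ω k ∈ S) ∧ ω n = z}) := by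
    have : ∫⁻ ω in A, V (ω n) ∂(P x) =
      ∫⁻ q : ℤ, V q ∂(((P x).restrict A).map fun ω => ω n) := by
      rw [lintegral_map (Measurable.of_discrete) (measurable_pi_apply n)]
    rw [this, lintegral_countable']
    congr 1; funext z
    rw [Measure.map_apply (measurable_pi_apply n) (measurableSet_singleton _),
      Measure.restrict_apply ((measurable_pi_apply n) (measurableSet_singleton _))]
    congr 2
    ext ω
    simp [hA, and_comm]
  rw [l1, l2]
  refine ENNReal.tsum_le_tsum fun z => ?_
  by_cases hz : z ∈ S
  · calc _ = ∑' w : ℤ, (K z w * V w) * P x {ω | (∀ k ≤ n, ω k ∈ S) ∧ ω n = z} := by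
          congr 1; funext w
          rw [one_step hcyl]
          ring
      _ = (∑' w : ℤ, (K z w * V w)) * P x {ω | (∀ k ≤ n, ω k ∈ S) ∧ ω n = z} :=
          ENNReal.tsum_mul_right
      _ ≤ _ := by gcongr; exact hV z hz
  · have : ∀ w, {ω : ℕ → ℤ | (∀ k ≤ n, ω k ∈ S) ∧ ω n = z ∧ ω (n + 1) = w} = ∅ := by
      intro w
      rw [Set.eq_empty_iff_forall_notMem]
      rintro ω ⟨h1, h2, -⟩
      exact hz (h2 ▸ h1 n le_rfl)
    simp [this]

lemma meas_exit (n : ℕ) (S : Set ℤ) :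
    MeasurableSet {ω : ℕ → ℤ | (∀ k ≤ n, ω k ∈ S) ∧ ω (n + 1) ∉ S} := by
  have h : MeasurableSet ((fun ω : ℕ → ℤ => ω (n + 1)) ⁻¹' Sᶜ) :=
    (measurable_pi_apply (n + 1)) (MeasurableSet.of_discrete (s := Sᶜ))
  exact (meas_stay n S).inter h

lemma exit_bound {K : ℤ → PMF ℤ} {P : ℤ → Measure (ℕ → ℤ)}
    (hprob : ∀ x, IsProbabilityMeasure (P x))
    (hcyl : ∀ (x : ℤ) (n : ℕ) (path : ℕ → ℤ),
      P x {ω | ∀ k ≤ n, ω k = path k} =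
        (if path 0 = x then 1 else 0) *
          ∏ k ∈ Finset.range n, K (path k) (path (k + 1)))
    (x : ℤ) (S : Set ℤ) (V : ℤ → ℝ≥0∞)
    (hV : ∀ z ∈ S, ∑' w, K z w * V w ≤ V z) :
    ∑' n : ℕ, ∫⁻ ω in {ω : ℕ → ℤ | (∀ k ≤ n, ω k ∈ S) ∧ ω (n + 1) ∉ S},
      V (ω (n + 1)) ∂(P x) ≤ V x := by
  apply ENNReal.tsum_le_of_sum_range_le
  intro N
  have key : ∀ N : ℕ, (∑ n ∈ Finset.range N,
      ∫⁻ ω in {ω : ℕ → ℤ | (∀ k ≤ n, ω k ∈ S) ∧ ω (n + 1) ∉ S}, V (ω (n + 1)) ∂(P x)) +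
      ∫⁻ ω in {ω : ℕ → ℤ | ∀ k ≤ N, ω k ∈ S}, V (ω N) ∂(P x) ≤ V x := by
    intro N
    induction N with
    | zero =>
      simp only [Finset.range_zero, Finset.sum_empty, zero_add]
      calc _ ≤ ∫⁻ ω, V (ω 0) ∂(P x) := setLIntegral_le_lintegral _ _
        _ = ∫⁻ ω, V x ∂(P x) := by
            apply lintegral_congr_ae
            filter_upwards [start_ae hprob hcyl x] with ω h
            rw [h]
        _ = V x := by
            have := hprob x
            simp
    | succ N ih =>
      refine le_trans ?_ ih
      rw [Finset.sum_range_succ, add_assoc]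
      gcongr
      refine le_trans (le_of_eq ?_) (super_step hcyl x N S V hV)
      have : {ω : ℕ → ℤ | ∀ k ≤ N, ω k ∈ S} =
        {ω : ℕ → ℤ | (∀ k ≤ N, ω k ∈ S) ∧ ω (N + 1) ∉ S} ∪
        {ω : ℕ → ℤ | ∀ k ≤ N + 1, ω k ∈ S} := by
        ext ω
        simp only [Set.mem_ofPred_eq, Set.mem_union]
        constructor
        · intro h
          by_cases h' : ω (N + 1) ∈ S
          · right
            intro k hk
            rcases Nat.lt_or_ge k (N + 1) with h3 | h3
            · exact h k (by omega)
            · have : k = N + 1 := by omega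
              rw [this]; exact h'
          · exact Or.inl ⟨h, h'⟩
        · rintro (h | h)
          · exact h.1
          · exact fun k hk => h k (by omega)
      rw [this, lintegral_union (meas_stay _ _)]
      exact Set.disjoint_left.mpr fun ω h1 h2 => h1.2 (h2 (N + 1) le_rfl)
  exact le_trans le_self_add (key N)

/-- Superharmonic function for a centred walk with finite variance killed on leaving `(0, ∞)`. -/
lemma lyap_real (q : ℤ → ℝ) (hq0 : ∀ y, 0 ≤ q y) (hqs : Summable q) (hq1 : ∑' y, q y = 1)
    (hint : Summable fun y : ℤ => |(y : ℝ)| * q y)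
    (hmean : ∑' y : ℤ, (y : ℝ) * q y = 0)
    (hsq : Summable fun y : ℤ => (y : ℝ) ^ 2 * q y)
    (hvar : 0 < ∑' y : ℤ, (y : ℝ) ^ 2 * q y) :
    ∃ (M : ℝ) (V : ℤ → ℝ), (∀ z, 0 ≤ V z) ∧ (∀ z : ℤ, -M - z ≤ V z) ∧
      ∀ z : ℤ, 0 < z → (Summable fun y => q y * V (z + y)) ∧ ∑' y, q y * V (z + y) ≤ V z := by
  have hid : Summable fun y : ℤ => (y : ℝ) * q y := by
    refine Summable.of_norm_bounded hint fun y => ?_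
    rw [Real.norm_eq_abs, abs_mul, abs_of_nonneg (hq0 y)]
  have hpos : Summable fun y : ℤ => max (y : ℝ) 0 * q y := by
    refine Summable.of_nonneg_of_le (fun y => mul_nonneg (le_max_right _ _) (hq0 y))
      (fun y => mul_le_mul_of_nonneg_right ?_ (hq0 y)) hint
    exact max_le (le_abs_self _) (abs_nonneg _)
  set κ : ℝ := ∑' y : ℤ, max (y : ℝ) 0 * q y with hκ
  have hκ0 : 0 < κ := by
    have hnn : 0 ≤ κ := tsum_nonneg fun y => mul_nonneg (le_max_right _ _) (hq0 y)
    rcases hnn.lt_or_eq with h | h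
    · exact h
    exfalso
    have habs : ∑' y : ℤ, |(y : ℝ)| * q y = 0 := by
      have : ∀ y : ℤ, |(y : ℝ)| * q y = 2 * (max (y : ℝ) 0 * q y) - (y : ℝ) * q y := by
        intro y
        rcases le_total 0 (y : ℝ) with h | h
        · rw [abs_of_nonneg h, max_eq_left h]; ring
        · rw [abs_of_nonpos h, max_eq_right h]; ring
      rw [tsum_congr this, (hpos.mul_left 2).tsum_sub hid, tsum_mul_left, hmean, ← hκ, ← h]
      simp
    have hz : ∀ y : ℤ, |(y : ℝ)| * q y = 0 := by
      have h1 := (hasSum_zero_iff_of_nonneg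
        (fun y : ℤ => mul_nonneg (abs_nonneg (y : ℝ)) (hq0 y))).mp (habs ▸ hint.hasSum)
      exact fun y => congrFun h1 y
    have : ∀ y : ℤ, (y : ℝ) ^ 2 * q y = 0 := by
      intro y
      rw [← sq_abs, sq, mul_assoc, hz y, mul_zero]
    simp [this] at hvar
  -- the overshoot function
  have hrs : ∀ t : ℝ, Summable fun y : ℤ => q y * max (t - y) 0 := by
    intro t
    refine Summable.of_nonneg_of_le (fun y => mul_nonneg (hq0 y) (le_max_right _ _))
      (fun y => ?_) ((hqs.mul_left |t|).add hint)
    rw [← add_mul, mul_comm]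
    refine mul_le_mul_of_nonneg_right ?_ (hq0 y)
    refine max_le ?_ (by positivity)
    linarith [le_abs_self t, neg_le_abs (y : ℝ)]
  let r : ℕ → ℝ := fun m => ∑' y : ℤ, q y * max (-(m : ℝ) - y) 0
  have hr0 : ∀ m, 0 ≤ r m := fun m => tsum_nonneg fun y => mul_nonneg (hq0 y) (le_max_right _ _)
  have hbd : ∀ (y : ℤ) (N : ℕ),
      ∑ m ∈ Finset.range N, max (-(m : ℝ) - y) 0 ≤ (y : ℝ) ^ 2 + |(y : ℝ)| := by
    intro y N
    have h1 : ∀ m ∈ Finset.range N, max (-(m : ℝ) - y) 0 ≤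
        if m ∈ Finset.range (y.natAbs + 1) then |(y : ℝ)| else 0 := by
      intro m _
      have hm0 : (0 : ℝ) ≤ m := Nat.cast_nonneg m
      split_ifs with h
      · exact max_le (by linarith [neg_le_abs (y : ℝ)]) (abs_nonneg _)
      · have h2 : y.natAbs + 1 ≤ m := by simpa using h
        have h3 : (-(m : ℤ) - y) ≤ 0 := by omega
        have h4 : (-(m : ℝ) - y) ≤ 0 := by exact_mod_cast h3
        exact max_le h4 le_rfl
    refine (Finset.sum_le_sum h1).trans ?_
    rw [← Finset.sum_filter, Finset.sum_const, nsmul_eq_mul]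
    have hc : ((Finset.filter (fun m => m ∈ Finset.range (y.natAbs + 1))
        (Finset.range N)).card : ℝ) ≤ |(y : ℝ)| + 1 := by
      have : (Finset.filter (fun m => m ∈ Finset.range (y.natAbs + 1))
        (Finset.range N)).card ≤ (Finset.range (y.natAbs + 1)).card := by
        apply Finset.card_le_card
        intro m hm
        exact (Finset.mem_filter.mp hm).2
      rw [Finset.card_range] at this
      have h2 : ((Finset.filter (fun m => m ∈ Finset.range (y.natAbs + 1))
        (Finset.range N)).card : ℝ) ≤ ((y.natAbs + 1 : ℕ) : ℝ) := by exact_mod_cast this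
      refine h2.trans (le_of_eq ?_)
      push_cast
      simp [Nat.cast_natAbs]
    calc _ ≤ (|(y : ℝ)| + 1) * |(y : ℝ)| := mul_le_mul_of_nonneg_right hc (abs_nonneg _)
      _ = _ := by rw [add_mul, one_mul, ← sq, sq_abs]
  have hrsum : Summable r := by
    refine summable_of_sum_range_le (c := ∑' y : ℤ, ((y : ℝ) ^ 2 * q y + |(y : ℝ)| * q y)) hr0 ?_
    intro N
    rw [← Summable.tsum_finsetSum (fun m _ => hrs _)]
    refine Summable.tsum_le_tsum (fun y => ?_) (summable_sum fun m _ => hrs _) (hsq.add hint)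
    rw [← Finset.mul_sum, ← add_mul, mul_comm]
    exact mul_le_mul_of_nonneg_right (hbd y N) (hq0 y)
  obtain ⟨M, hM⟩ : ∃ M : ℕ, ∑' i, r (i + (M + 1)) < κ / 2 := by
    have h1 := (tendsto_sum_nat_add r).comp (tendsto_add_atTop_nat 1)
    have h2 := (h1.eventually (gt_mem_nhds (show (0 : ℝ) < κ / 2 by linarith))).exists
    exact h2
  let g : ℕ → ℝ := fun i => 2 / κ * r (i + (M + 1))
  have hg0 : ∀ i, 0 ≤ g i := fun i => mul_nonneg (by positivity) (hr0 _)
  have hgs : Summable g := ((summable_nat_add_iff (M + 1)).mpr hrsum).mul_left _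
  set s := ∑' i, g i with hs
  have hs0 : 0 ≤ s := tsum_nonneg hg0
  have hs1 : s ≤ 1 := by
    rw [hs, tsum_mul_left]
    calc _ ≤ 2 / κ * (κ / 2) := mul_le_mul_of_nonneg_left hM.le (by positivity)
      _ = 1 := by field_simp
  let U : ℝ → ℝ := fun z => ∑' i : ℕ, g i * max (z - i - 1) 0
  have hUs : ∀ z : ℝ, Summable fun i : ℕ => g i * max (z - i - 1) 0 := by
    intro z
    refine Summable.of_nonneg_of_le (fun i => mul_nonneg (hg0 i) (le_max_right _ _))
      (fun i => mul_le_mul_of_nonneg_left ?_ (hg0 i)) (hgs.mul_right |z|)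
    have : (0 : ℝ) ≤ i := Nat.cast_nonneg i
    exact max_le (by linarith [le_abs_self z]) (abs_nonneg z)
  have hU0 : ∀ z, 0 ≤ U z := fun z => tsum_nonneg fun i => mul_nonneg (hg0 i) (le_max_right _ _)
  have hM0 : (0 : ℝ) ≤ M := Nat.cast_nonneg M
  have hUle : ∀ z : ℝ, U z ≤ s * max z 0 := by
    intro z
    rw [hs, ← tsum_mul_right]
    refine Summable.tsum_le_tsum (fun i => mul_le_mul_of_nonneg_left ?_ (hg0 i)) (hUs z)
      (hgs.mul_right _)
    have : (0 : ℝ) ≤ i := Nat.cast_nonneg i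
    exact max_le_max (by linarith) le_rfl
  let V : ℤ → ℝ := fun z => s * (z + M) + 2 * max (-(M : ℝ) - z) 0 - U z
  have hVlow : ∀ z : ℤ, max (-(M : ℝ) - z) 0 ≤ V z := by
    intro z
    have h1 := hUle z
    simp only [V]
    rcases le_total 0 (z : ℝ) with h | h
    · rw [max_eq_left h] at h1
      rw [max_eq_right (by linarith)]
      nlinarith
    · rw [max_eq_right h] at h1
      rcases le_total (-(M : ℝ) - z) 0 with h' | h'
      · rw [max_eq_right h']
        nlinarith
      · rw [max_eq_left h']
        nlinarith
  refine ⟨M, V, fun z => (le_max_right _ _).trans (hVlow z),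
    fun z => (le_max_left _ _).trans (hVlow z), ?_⟩
  intro z hz
  obtain ⟨n, rfl⟩ : ∃ n : ℕ, z = n + 1 := ⟨(z - 1).toNat, by omega⟩
  have hV0 : ∀ z, 0 ≤ V z := fun z => (le_max_right _ _).trans (hVlow z)
  -- supporting line
  let G : ℝ := ∑' i : ℕ, if i < n then g i else 0
  have hGs : Summable fun i : ℕ => if i < n then g i else 0 := by
    refine Summable.of_nonneg_of_le (fun i => ?_) (fun i => ?_) hgs
    · split_ifs
      · exact hg0 i
      · exact le_rfl
    · split_ifs
      · exact le_rfl
      · exact hg0 i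
  have hline : ∀ y : ℤ, U ((n : ℝ) + 1) + y * G + g n * max (y : ℝ) 0 ≤ U ((n : ℝ) + 1 + y) := by
    intro y
    have e1 : HasSum (fun i : ℕ => g i * max ((n : ℝ) + 1 - i - 1) 0 +
        y * (if i < n then g i else 0) + (if i = n then g n * max (y : ℝ) 0 else 0))
        (U ((n : ℝ) + 1) + y * G + g n * max (y : ℝ) 0) :=
      (((hUs _).hasSum).add (hGs.hasSum.mul_left _)).add (hasSum_ite_eq n _)
    refine hasSum_le (fun i => ?_) e1 (hUs _).hasSum
    have hgi := hg0 i
    rcases lt_trichotomy i n with h | h | h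
    · rw [if_pos h, if_neg h.ne, add_zero]
      have h' : (i : ℝ) < n := by exact_mod_cast h
      rw [max_eq_left (by linarith)]
      have := mul_le_mul_of_nonneg_left (le_max_left ((n : ℝ) + 1 + y - i - 1) 0) hgi
      linarith
    · subst h
      simp only [lt_irrefl, if_false, if_true, mul_zero, add_zero]
      have a1 : (i : ℝ) + 1 - i - 1 = 0 := by ring
      have a2 : (i : ℝ) + 1 + y - i - 1 = y := by ring
      rw [a1, a2]
      simp
    · rw [if_neg (by omega), if_neg (by omega)]
      have h' : (n : ℝ) < i := by exact_mod_cast h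
      rw [max_eq_right (by linarith)]
      simp only [mul_zero, add_zero]
      exact mul_nonneg hgi (le_max_right _ _)
  have hpt : ∀ y : ℤ, V ((n : ℤ) + 1 + y) ≤ V ((n : ℤ) + 1) + (s - G) * y +
      2 * max (-((n + (M + 1) : ℕ) : ℝ) - y) 0 - g n * max (y : ℝ) 0 := by
    intro y
    have h1 := hline y
    simp only [V]
    push_cast
    have h2 : (-(M : ℝ) - ((n : ℝ) + 1 + y)) = (-((n : ℝ) + (M + 1)) - y) := by ring
    rw [h2]
    have h3 := le_max_right (-(M : ℝ) - ((n : ℝ) + 1)) 0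
    nlinarith
  have hsumB : HasSum (fun y : ℤ => V ((n : ℤ) + 1) * q y + (s - G) * ((y : ℝ) * q y) +
      2 * (q y * max (-((n + (M + 1) : ℕ) : ℝ) - y) 0) - g n * (max (y : ℝ) 0 * q y))
      (V ((n : ℤ) + 1) * 1 + (s - G) * 0 + 2 * r (n + (M + 1)) - g n * κ) := by
    refine HasSum.sub (HasSum.add (HasSum.add ?_ ?_) ?_) ?_
    · exact (hq1 ▸ hqs.hasSum).mul_left _
    · exact (hmean ▸ hid.hasSum).mul_left _
    · exact (hrs _).hasSum.mul_left _
    · exact hpos.hasSum.mul_left _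
  have hle : ∀ y : ℤ, q y * V ((n : ℤ) + 1 + y) ≤
      V ((n : ℤ) + 1) * q y + (s - G) * ((y : ℝ) * q y) +
      2 * (q y * max (-((n + (M + 1) : ℕ) : ℝ) - y) 0) - g n * (max (y : ℝ) 0 * q y) := by
    intro y
    refine (mul_le_mul_of_nonneg_left (hpt y) (hq0 y)).trans (le_of_eq ?_)
    ring
  have hsm : Summable fun y => q y * V ((n : ℤ) + 1 + y) :=
    Summable.of_nonneg_of_le (fun y => mul_nonneg (hq0 y) (hV0 _)) hle hsumB.summable
  refine ⟨hsm, ?_⟩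
  refine (hasSum_le hle hsm.hasSum hsumB).trans (le_of_eq ?_)
  have : g n * κ = 2 * r (n + (M + 1)) := by
    simp only [g]
    field_simp
  rw [this]
  ring

lemma lyap_ennreal (ξ : PMF ℤ) (v : ℝ) (hv : 0 < v)
    (hint : Summable fun y : ℤ => |(y : ℝ)| * (ξ y).toReal)
    (hmean : ∑' y : ℤ, (y : ℝ) * (ξ y).toReal = 0)
    (hsq : Summable fun y : ℤ => (y : ℝ) ^ 2 * (ξ y).toReal)
    (hvar : v ^ 2 = ∑' y : ℤ, (y : ℝ) ^ 2 * (ξ y).toReal) (x : ℤ) :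
    ∃ V : ℤ → ℝ≥0∞, (∀ z, V z ≠ ⊤) ∧
      (∀ z : ℤ, ENNReal.ofReal ((x : ℝ) - z) ≤ V z) ∧
      ∀ z : ℤ, 0 < z → ∑' y, ξ y * V (z + y) ≤ V z := by
  have hne : ∀ y, ξ y ≠ ⊤ := fun y => ξ.apply_ne_top y
  have hqs : Summable fun y => (ξ y).toReal := ENNReal.summable_toReal ξ.tsum_coe_ne_top
  have hq1 : ∑' y, (ξ y).toReal = 1 := by
    rw [← ENNReal.tsum_toReal_eq hne, ξ.tsum_coe, ENNReal.toReal_one]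
  obtain ⟨M, V, hV0, hVM, hsup⟩ := lyap_real (fun y => (ξ y).toReal)
    (fun y => ENNReal.toReal_nonneg) hqs hq1 hint hmean hsq (hvar ▸ by positivity)
  set c : ℝ := max ((x : ℝ) + M) 0
  have hc : 0 ≤ c := le_max_right _ _
  refine ⟨fun z => ENNReal.ofReal (V z + c), fun z => ENNReal.ofReal_ne_top, fun z => ?_,
    fun z hz => ?_⟩
  · apply ENNReal.ofReal_le_ofReal
    have := hVM z
    have := le_max_left ((x : ℝ) + M) 0
    linarith
  · obtain ⟨h1, h2⟩ := hsup z hz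
    have h3 : HasSum (fun y => (ξ y).toReal * (V (z + y) + c))
        (∑' y, (ξ y).toReal * V (z + y) + 1 * c) := by
      simp only [mul_add]
      exact h1.hasSum.add ((hq1 ▸ hqs.hasSum).mul_right c)
    calc ∑' y, ξ y * ENNReal.ofReal (V (z + y) + c)
        = ∑' y, ENNReal.ofReal ((ξ y).toReal * (V (z + y) + c)) := by
          congr 1; funext y
          rw [ENNReal.ofReal_mul ENNReal.toReal_nonneg, ENNReal.ofReal_toReal (hne y)]
      _ = ENNReal.ofReal (∑' y, (ξ y).toReal * (V (z + y) + c)) := by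
          rw [ENNReal.ofReal_tsum_of_nonneg _ h3.summable]
          exact fun y => mul_nonneg ENNReal.toReal_nonneg (add_nonneg (hV0 _) hc)
      _ ≤ _ := by
          rw [h3.tsum_eq]
          apply ENNReal.ofReal_le_ofReal
          linarith

lemma meas_disp (n : ℕ) : Measurable fun ω : ℕ → ℤ =>
    ENNReal.ofReal |((ω 0 - ω (n + 1) : ℤ) : ℝ)| := by
  have h1 : Measurable fun ω : ℕ → ℤ => ω 0 - ω (n + 1) :=
    (measurable_pi_apply 0).sub (measurable_pi_apply (n + 1))
  have h2 : Measurable fun q : ℤ => ENNReal.ofReal |(q : ℝ)| :=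
    Measurable.of_discrete
  exact Measurable.comp (g := fun q : ℤ => ENNReal.ofReal |(q : ℝ)|)
    (f := fun ω : ℕ → ℤ => ω 0 - ω (n + 1)) h2 h1

lemma disp_facts {d : ℤ} (hd : 0 ≤ d) {K : ℤ → PMF ℤ} {P : ℤ → Measure (ℕ → ℤ)}
    (hprob : ∀ x, IsProbabilityMeasure (P x))
    (hcyl : ∀ (x : ℤ) (n : ℕ) (path : ℕ → ℤ),
      P x {ω | ∀ k ≤ n, ω k = path k} =
        (if path 0 = x then 1 else 0) *
          ∏ k ∈ Finset.range n, K (path k) (path (k + 1)))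
    (hB4 : ∀ x y : ℤ, d < |x| → d < |y| → ∃ n : ℕ, iterK K n x y ≠ 0)
    {S : Set ℤ} (hS : IsSide d S) {x : ℤ} (hx : x ∈ S) (V : ℤ → ℝ≥0∞) (hVx : V x ≠ ⊤)
    (hVlow : ∀ w, w ∉ S → ENNReal.ofReal |((x - w : ℤ) : ℝ)| ≤ V w)
    (hV : ∀ z ∈ S, ∑' w, K z w * V w ≤ V z) :
    0 < ∫ ω, |((ω 0 - ω (crossTimes d 1 ω).1 : ℤ) : ℝ)| ∂(P x) := by
  let E : ℕ → Set (ℕ → ℤ) := fun n => {ω | (∀ k ≤ n, ω k ∈ S) ∧ ω (n + 1) ∉ S}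
  let F : ℕ → (ℕ → ℤ) → ℝ≥0∞ := fun n =>
    (E n).indicator fun ω => ENNReal.ofReal |((ω 0 - ω (n + 1) : ℤ) : ℝ)|
  have hFm : ∀ n, Measurable (F n) := by
    intro n
    refine Measurable.indicator ?_ (meas_exit n S)
    exact meas_disp n
  have hpt : ∀ ω : ℕ → ℤ, ω 0 = x →
      ∑' n, F n ω = ENNReal.ofReal |((ω 0 - ω (crossTimes d 1 ω).1 : ℤ) : ℝ)| := by
    intro ω h0
    rcases exit_or_stay ω (h0 ▸ hx) with h | ⟨n, h1, h2⟩
    · rw [cross_one_stay hd hS ω h]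
      have : ∀ n, F n ω = 0 := fun n => Set.indicator_of_notMem (fun hE => hE.2 (h _)) _
      simp [this]
    · rw [cross_one_exit hd hS ω n h1 h2, tsum_eq_single n]
      · exact Set.indicator_of_mem (show ω ∈ E n from ⟨h1, h2⟩) _
      · intro m hm
        refine Set.indicator_of_notMem (fun hE => ?_) _
        obtain ⟨e1, e2⟩ := hE
        rcases Nat.lt_or_gt_of_ne hm with h | h
        · exact e2 (h1 _ (by omega))
        · exact h2 (e1 _ (by omega))
  have hae := start_ae hprob hcyl x
  have hmeas : AEMeasurable (fun ω => |((ω 0 - ω (crossTimes d 1 ω).1 : ℤ) : ℝ)|) (P x) := by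
    refine ⟨fun ω => (∑' n, F n ω).toReal, (Measurable.ennreal_tsum hFm).ennreal_toReal, ?_⟩
    filter_upwards [hae] with ω h
    rw [hpt ω h, ENNReal.toReal_ofReal (abs_nonneg _)]
  have hfin : ∫⁻ ω, ENNReal.ofReal |((ω 0 - ω (crossTimes d 1 ω).1 : ℤ) : ℝ)| ∂(P x) ≤ V x := by
    calc _ = ∫⁻ ω, ∑' n, F n ω ∂(P x) := by
          apply lintegral_congr_ae
          filter_upwards [hae] with ω h
          rw [hpt ω h]
      _ = ∑' n, ∫⁻ ω, F n ω ∂(P x) := lintegral_tsum fun n => (hFm n).aemeasurable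
      _ ≤ ∑' n, ∫⁻ ω in E n, V (ω (n + 1)) ∂(P x) := by
          refine ENNReal.tsum_le_tsum fun n => ?_
          rw [← lintegral_indicator (meas_exit n S)]
          apply lintegral_mono_ae
          filter_upwards [hae] with ω h
          by_cases hω : ω ∈ E n
          · simp only [F]
            rw [Set.indicator_of_mem hω, Set.indicator_of_mem hω, h]
            exact hVlow _ hω.2
          · simp only [F]
            rw [Set.indicator_of_notMem hω]
            exact zero_le
      _ ≤ V x := exit_bound hprob hcyl x S V hV
  have hint : Integrable (fun ω => |((ω 0 - ω (crossTimes d 1 ω).1 : ℤ) : ℝ)|) (P x) := by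
    refine ⟨hmeas.aestronglyMeasurable, ?_⟩
    rw [hasFiniteIntegral_iff_ofReal (Eventually.of_forall fun ω => abs_nonneg _)]
    exact lt_of_le_of_lt hfin (lt_top_iff_ne_top.mpr hVx)
  rw [integral_pos_iff_support_of_nonneg (fun ω => abs_nonneg _) hint]
  have hxa := side_abs hd hS hx
  obtain ⟨n, hn⟩ := hB4 x (-x) hxa (by rwa [abs_neg])
  obtain ⟨p, p0, pn, hp⟩ := iterK_path K n x (-x) hn
  have hnx : -x ∉ S := by
    rcases hS with rfl | rfl
    · simp only [Set.mem_ofPred_eq] at hx ⊢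
      omega
    · simp only [Set.mem_ofPred_eq] at hx ⊢
      omega
  obtain ⟨k, hk, hin, hout⟩ := first_exit p n (p0 ▸ hx) (pn ▸ hnx)
  have hpos := cyl_pos hcyl p (k + 1) (fun j hj => hp j (by omega))
  rw [p0] at hpos
  refine lt_of_lt_of_le (pos_iff_ne_zero.mpr hpos) (measure_mono ?_)
  intro ω hω
  have hω' : ∀ j ≤ k + 1, ω j = p j := hω
  rw [Function.mem_support, cross_one_exit hd hS ω k
    (fun j hj => by rw [hω' j (by omega)]; exact hin j hj)
    (by rw [hω' _ le_rfl]; exact hout), hω' _ le_rfl, hω' 0 (Nat.zero_le _), p0]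
  intro h
  rw [abs_eq_zero] at h
  have h3 : x - p (k + 1) = 0 := by exact_mod_cast h
  have h4 : p (k + 1) = x := by omega
  exact hout (h4 ▸ hx)

lemma map_neg_apply (ξ : PMF ℤ) (y : ℤ) : (ξ.map fun z => -z) y = ξ (-y) := by
  rw [PMF.map_apply, tsum_eq_single (-y)]
  · simp
  · intro b hb
    rw [if_neg]
    intro h
    apply hb
    omega

lemma sign_cross {d : ℤ} (hd : 0 ≤ d) (ω : ℕ → ℤ) :
    (d < ω 0 → 0 ≤ ω 0 - ω (crossTimes d 1 ω).1) ∧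
    (ω 0 < -d → ω 0 - ω (crossTimes d 1 ω).1 ≤ 0) := by
  constructor
  · intro h
    rcases exit_or_stay (S := {z | d < z}) ω h with h1 | ⟨n, h1, h2⟩
    · rw [cross_one_stay hd (Or.inl rfl) ω h1]
      omega
    · rw [cross_one_exit hd (Or.inl rfl) ω n h1 h2]
      simp only [Set.mem_ofPred_eq] at h2
      omega
  · intro h
    rcases exit_or_stay (S := {z | z < -d}) ω h with h1 | ⟨n, h1, h2⟩
    · rw [cross_one_stay hd (Or.inr rfl) ω h1]
      omega
    · rw [cross_one_exit hd (Or.inr rfl) ω n h1 h2]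
      simp only [Set.mem_ofPred_eq] at h2
      omega

lemma phi_vsgn (vp vm : ℝ) (t : ℤ) :
    phi vp vm (t : ℝ) = (t : ℝ) * (vsgn vp vm t)⁻¹ := by
  unfold phi vsgn
  rcases lt_or_ge t 0 with h | h
  · rw [if_pos h, if_neg (by push Not; exact_mod_cast h), div_eq_mul_inv]
  · rw [if_neg (not_lt.mpr h), if_pos (by exact_mod_cast h), div_eq_mul_inv]

lemma vsgn_pos {vp vm : ℝ} (hvp : 0 < vp) (hvm : 0 < vm) (t : ℤ) : 0 < vsgn vp vm t := by
  unfold vsgn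
  split_ifs <;> assumption

theorem stmt_12 (d : ℤ) (hd : 0 ≤ d)
    (K : ℤ → PMF ℤ) (P : ℤ → Measure (ℕ → ℤ))
    (hprob : ∀ x, IsProbabilityMeasure (P x))
    (hcyl : ∀ (x : ℤ) (n : ℕ) (path : ℕ → ℤ),
      P x {ω | ∀ k ≤ n, ω k = path k} =
        (if path 0 = x then 1 else 0) *
          ∏ k ∈ Finset.range n, K (path k) (path (k + 1)))
    -- (B1)
    (ξp ξm : PMF ℤ) (vp vm : ℝ) (hvp : 0 < vp) (hvm : 0 < vm)
    (hB1p : ∀ x : ℤ, d < x → ∀ y : ℤ, K x (x + y) = ξp y)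
    (hB1m : ∀ x : ℤ, x < -d → ∀ y : ℤ, K x (x + y) = ξm y)
    (hintp : Summable fun y : ℤ => |(y : ℝ)| * (ξp y).toReal)
    (hintm : Summable fun y : ℤ => |(y : ℝ)| * (ξm y).toReal)
    (hmeanp : ∑' y : ℤ, (y : ℝ) * (ξp y).toReal = 0)
    (hmeanm : ∑' y : ℤ, (y : ℝ) * (ξm y).toReal = 0)
    (hsqp : Summable fun y : ℤ => (y : ℝ) ^ 2 * (ξp y).toReal)
    (hsqm : Summable fun y : ℤ => (y : ℝ) ^ 2 * (ξm y).toReal)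
    (hvarp : vp ^ 2 = ∑' y : ℤ, (y : ℝ) ^ 2 * (ξp y).toReal)
    (hvarm : vm ^ 2 = ∑' y : ℤ, (y : ℝ) ^ 2 * (ξm y).toReal)
    (harithp : ∀ n : ℕ, 1 ≤ n → (∀ y : ℤ, ξp y ≠ 0 → (n : ℤ) ∣ y) → n = 1)
    (harithm : ∀ n : ℕ, 1 ≤ n → (∀ y : ℤ, ξm y ≠ 0 → (n : ℤ) ∣ y) → n = 1)
    -- (B2)
    (hB2 : ∀ x : ℤ, |x| ≤ d → P x {ω | ∃ k, d < |ω k|} = 1)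
    -- (B3)
    (hB3 : ∀ x : ℤ, |x| ≤ d →
      ∫⁻ ω, ((ω (crossTimes d 0 ω).2).natAbs : ℝ≥0∞) ∂(P x) ≠ ⊤)
    -- (B4)
    (hB4 : ∀ x y : ℤ, d < |x| → d < |y| → ∃ n : ℕ, iterK K n x y ≠ 0)
    -- the stationary entrance distribution
    (πent : Measure ℤ) (hπ : EntranceStationary d P πent)
    -- `γ := E_{π_ent}[φ(X(0) − X(σ̃₁))] / E_{π_ent}[|φ(X(0) − X(σ̃₁))|]`
    (γ : ℝ)
    (hγ : γ =
      (∑' x : ℤ, (πent {x}).toReal *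
        ∫ ω, phi vp vm ((ω 0 - ω (crossTimes d 1 ω).1 : ℤ) : ℝ) ∂(P x)) /
      (∑' x : ℤ, (πent {x}).toReal *
        ∫ ω, |phi vp vm ((ω 0 - ω (crossTimes d 1 ω).1 : ℤ) : ℝ)| ∂(P x))) :
    γ =
      (∑' x : ℤ, (πent {x}).toReal *
        ∫ ω, ((ω 0 - ω (crossTimes d 1 ω).1 : ℤ) : ℝ) *
          (vsgn vp vm (ω 0 - ω (crossTimes d 1 ω).1))⁻¹ ∂(P x)) /
      (∑' x : ℤ, (πent {x}).toReal *
        ∫ ω, |((ω 0 - ω (crossTimes d 1 ω).1 : ℤ) : ℝ)| *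
          (vsgn vp vm (ω 0 - ω (crossTimes d 1 ω).1))⁻¹ ∂(P x)) ∧
    γ =
      (∑' x : ℤ, (πent {x}).toReal *
        ∫ ω, ((ω 0 - ω (crossTimes d 1 ω).1 : ℤ) : ℝ) *
          (vsgn vp vm (ω 0))⁻¹ ∂(P x)) /
      (∑' x : ℤ, (πent {x}).toReal *
        ∫ ω, |((ω 0 - ω (crossTimes d 1 ω).1 : ℤ) : ℝ)| *
          (vsgn vp vm (ω 0))⁻¹ ∂(P x)) ∧
    -1 < γ ∧ γ < 1 := by
  have habs_phi : ∀ t : ℤ, |phi vp vm (t : ℝ)| = |(t : ℝ)| * (vsgn vp vm t)⁻¹ := by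
    intro t
    rw [phi_vsgn, abs_mul, abs_of_pos (inv_pos.mpr (vsgn_pos hvp hvm t))]
  have hsupp : ∀ x, πent {x} ≠ 0 → d < |x| := by
    intro x hx
    by_contra hle
    apply hx
    refine measure_mono_null ?_ hπ.2.1
    intro y hy
    rw [Set.mem_singleton_iff] at hy
    subst hy
    exact not_lt.mp hle
  have hside : ∀ z : ℤ, d < |z| → z ∈ {z : ℤ | d < z} ∨ z ∈ {z : ℤ | z < -d} := by
    intro z hz
    rcases lt_abs.mp hz with h | h
    · exact Or.inl h
    · right
      change z < -d
      omega
  have hdiff : ∀ (x : ℤ) (ω : ℕ → ℤ), d < |x| → ω 0 = x →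
      ω 0 - ω (crossTimes d 1 ω).1 = 0 ∨
      vsgn vp vm (ω 0 - ω (crossTimes d 1 ω).1) = vsgn vp vm (ω 0) := by
    intro x ω hx h0
    obtain ⟨h1, h2⟩ := sign_cross hd ω
    by_cases hz : ω 0 - ω (crossTimes d 1 ω).1 = 0
    · exact Or.inl hz
    right
    rcases hside x hx with h | h
    · have h' : d < ω 0 := h0 ▸ h
      have := h1 h'
      unfold vsgn
      rw [if_neg (by omega), if_neg (by omega)]
    · have h' : ω 0 < -d := h0 ▸ h
      have := h2 h'
      unfold vsgn
      rw [if_pos (by omega), if_pos (by omega)]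
  -- the two numerators and denominators rewritten
  have hN3 : ∀ x : ℤ, (πent {x}).toReal *
        ∫ ω, phi vp vm ((ω 0 - ω (crossTimes d 1 ω).1 : ℤ) : ℝ) ∂(P x) =
      (πent {x}).toReal *
        ∫ ω, ((ω 0 - ω (crossTimes d 1 ω).1 : ℤ) : ℝ) * (vsgn vp vm (ω 0))⁻¹ ∂(P x) := by
    intro x
    by_cases hx : πent {x} = 0
    · simp [hx]
    congr 1
    apply integral_congr_ae
    filter_upwards [start_ae hprob hcyl x] with ω h0
    rw [phi_vsgn]
    rcases hdiff x ω (hsupp x hx) h0 with h | h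
    · rw [h]; simp
    · rw [h]
  have hD3 : ∀ x : ℤ, (πent {x}).toReal *
        ∫ ω, |phi vp vm ((ω 0 - ω (crossTimes d 1 ω).1 : ℤ) : ℝ)| ∂(P x) =
      (πent {x}).toReal *
        ∫ ω, |((ω 0 - ω (crossTimes d 1 ω).1 : ℤ) : ℝ)| * (vsgn vp vm (ω 0))⁻¹ ∂(P x) := by
    intro x
    by_cases hx : πent {x} = 0
    · simp [hx]
    congr 1
    apply integral_congr_ae
    filter_upwards [start_ae hprob hcyl x] with ω h0
    rw [habs_phi]
    rcases hdiff x ω (hsupp x hx) h0 with h | h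
    · rw [h]; simp
    · rw [h]
  refine ⟨?_, ?_, ?_⟩
  · rw [hγ]
    simp only [habs_phi]
    simp only [phi_vsgn]
  · rw [hγ, tsum_congr hN3, tsum_congr hD3]
  -- positivity of the mean displacement
  have hpos : ∀ x : ℤ, d < |x| →
      0 < ∫ ω, |((ω 0 - ω (crossTimes d 1 ω).1 : ℤ) : ℝ)| ∂(P x) := by
    intro x hx
    rcases hside x hx with h | h
    · obtain ⟨V, hV1, hV2, hV3⟩ := lyap_ennreal ξp vp hvp hintp hmeanp hsqp hvarp (x - d)
      refine disp_facts hd hprob hcyl hB4 (Or.inl rfl) h (fun z => V (z - d)) (hV1 _) ?_ ?_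
      · intro w hw
        have hw' : w ≤ d := not_lt.mp hw
        have hx' : d < x := h
        have h1 : (0 : ℝ) ≤ ((x - w : ℤ) : ℝ) := by
          have : 0 ≤ x - w := by omega
          exact_mod_cast this
        rw [abs_of_nonneg h1]
        refine le_trans (le_of_eq ?_) (hV2 (w - d))
        congr 1
        push_cast
        ring
      · intro z hz
        have hz' : d < z := hz
        rw [← (Equiv.addLeft z).tsum_eq]
        refine le_trans (le_of_eq ?_) (hV3 (z - d) (by omega))
        congr 1
        funext y
        simp only [Equiv.coe_addLeft]
        rw [hB1p z hz' y]
        congr 2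
        ring
    · have eneg : ∀ f : ℤ → ℝ, (Summable f → Summable fun y => f (-y)) ∧
          ∑' y, f (-y) = ∑' y, f y := fun f =>
        ⟨fun hf => (Equiv.neg ℤ).summable_iff.mpr hf, (Equiv.neg ℤ).tsum_eq f⟩
      obtain ⟨V, hV1, hV2, hV3⟩ := lyap_ennreal (ξm.map fun z => -z) vm hvm
        (by
          simp only [map_neg_apply]
          refine ((eneg _).1 hintm).congr fun y => ?_
          push_cast
          rw [abs_neg])
        (by
          simp only [map_neg_apply]
          have h1 := (eneg fun y : ℤ => (y : ℝ) * (ξm y).toReal).2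
          rw [hmeanm] at h1
          simp only [Int.cast_neg, neg_mul, tsum_neg] at h1
          linarith)
        (by
          simp only [map_neg_apply]
          refine ((eneg _).1 hsqm).congr fun y => ?_
          push_cast
          rw [neg_sq])
        (by
          simp only [map_neg_apply]
          rw [hvarm, ← (eneg _).2]
          refine tsum_congr fun y => ?_
          push_cast
          rw [neg_sq]) (-x - d)
      refine disp_facts hd hprob hcyl hB4 (Or.inr rfl) h (fun z => V (-z - d)) (hV1 _) ?_ ?_
      · intro w hw
        have hw' : -d ≤ w := not_lt.mp hw
        have hx' : x < -d := h
        have h1 : ((x - w : ℤ) : ℝ) ≤ 0 := by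
          have : x - w ≤ 0 := by omega
          exact_mod_cast this
        rw [abs_of_nonpos h1]
        refine le_trans (le_of_eq ?_) (hV2 (-w - d))
        congr 1
        push_cast
        ring
      · intro z hz
        have hz' : z < -d := hz
        rw [← (Equiv.subLeft z).tsum_eq]
        refine le_trans (le_of_eq ?_) (hV3 (-z - d) (by omega))
        congr 1
        funext y
        simp only [Equiv.subLeft_apply, map_neg_apply]
        rw [sub_eq_add_neg, hB1m z hz' (-y)]
        congr 2
        ring
  set N : ℤ → ℝ := fun x => (πent {x}).toReal *
        ∫ ω, phi vp vm ((ω 0 - ω (crossTimes d 1 ω).1 : ℤ) : ℝ) ∂(P x) with hN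
  set D : ℤ → ℝ := fun x => (πent {x}).toReal *
        ∫ ω, |phi vp vm ((ω 0 - ω (crossTimes d 1 ω).1 : ℤ) : ℝ)| ∂(P x) with hD
  have := hπ.1
  have hDpos : ∀ x, πent {x} ≠ 0 → 0 < D x := by
    intro x hx
    rw [hD]
    simp only
    rw [hD3 x]
    refine mul_pos (ENNReal.toReal_pos hx (measure_ne_top _ _)) ?_
    have : ∫ ω, |((ω 0 - ω (crossTimes d 1 ω).1 : ℤ) : ℝ)| * (vsgn vp vm (ω 0))⁻¹ ∂(P x) =
        ∫ ω, |((ω 0 - ω (crossTimes d 1 ω).1 : ℤ) : ℝ)| * (vsgn vp vm x)⁻¹ ∂(P x) := by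
      apply integral_congr_ae
      filter_upwards [start_ae hprob hcyl x] with ω h0
      rw [h0]
    rw [this, integral_mul_const]
    exact mul_pos (hpos x (hsupp x hx)) (inv_pos.mpr (vsgn_pos hvp hvm x))
  have hD0 : ∀ x, 0 ≤ D x := fun x =>
    mul_nonneg ENNReal.toReal_nonneg (integral_nonneg fun ω => abs_nonneg _)
  have hNp : ∀ x, d < x → N x = D x := by
    intro x hx
    simp only [hN, hD]
    congr 1
    apply integral_congr_ae
    filter_upwards [start_ae hprob hcyl x] with ω h0
    have h1 := (sign_cross hd ω).1 (h0 ▸ hx)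
    have h2 : (0 : ℝ) ≤ ((ω 0 - ω (crossTimes d 1 ω).1 : ℤ) : ℝ) := by exact_mod_cast h1
    rw [habs_phi, phi_vsgn, abs_of_nonneg h2]
  have hNm : ∀ x, x < -d → N x = - D x := by
    intro x hx
    simp only [hN, hD]
    rw [← mul_neg, ← integral_neg]
    congr 1
    apply integral_congr_ae
    filter_upwards [start_ae hprob hcyl x] with ω h0
    have h1 := (sign_cross hd ω).2 (h0 ▸ hx)
    have h2 : ((ω 0 - ω (crossTimes d 1 ω).1 : ℤ) : ℝ) ≤ 0 := by exact_mod_cast h1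
    rw [habs_phi, phi_vsgn, abs_of_nonpos h2]
    ring
  have hNz : ∀ x, πent {x} = 0 → N x = 0 ∧ D x = 0 := by
    intro x hx
    simp [hN, hD, hx]
  have hND : ∀ x, |N x| = D x := by
    intro x
    by_cases hx : πent {x} = 0
    · simp [hNz x hx]
    rcases hside x (hsupp x hx) with h | h
    · rw [hNp x h, abs_of_nonneg (hD0 x)]
    · rw [hNm x h, abs_neg, abs_of_nonneg (hD0 x)]
  by_cases hsD : Summable D
  swap
  · rw [hγ, tsum_eq_zero_of_not_summable hsD]
    simp
  have hsN : Summable N := by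
    refine Summable.of_norm_bounded hsD fun x => ?_
    rw [Real.norm_eq_abs, hND]
  -- both sides are charged
  obtain ⟨x₀, hx₀⟩ : ∃ x, πent {x} ≠ 0 := by
    by_contra hcon
    push Not at hcon
    have h1 : πent Set.univ = 0 := by
      rw [← Set.iUnion_of_singleton ℤ]
      exact measure_iUnion_null hcon
    rw [measure_univ] at h1
    exact one_ne_zero h1
  have hch : ∀ (S S' : Set ℤ), IsSide d S → IsSide d S' → (∀ z, d < |z| → z ∈ S ∨ z ∈ S') →
      (∀ z ∈ S, z ∉ S') → ∀ y ∈ S, ∃ z ∈ S, πent {z} ≠ 0 := by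
    intro S S' hS hS' h1 h2 y hy
    obtain ⟨n, hn⟩ := hB4 x₀ y (hsupp _ hx₀) (side_abs hd hS hy)
    obtain ⟨p, p0, pn, hp⟩ := iterK_path K n x₀ y hn
    exact support_step hd hcyl hπ hS hS' h1 h2 n p (p0 ▸ hx₀) hp (pn ▸ hy)
  obtain ⟨a, ha, hπa⟩ := hch {z : ℤ | d < z} {z : ℤ | z < -d} (Or.inl rfl) (Or.inr rfl) hside
    (fun z hz hz' => by
      have h1 : d < z := hz
      have h2 : z < -d := hz'
      omega) (d + 1) (show d < d + 1 by omega)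
  obtain ⟨b, hb, hπb⟩ := hch {z : ℤ | z < -d} {z : ℤ | d < z} (Or.inr rfl) (Or.inl rfl)
    (fun z hz => (hside z hz).symm)
    (fun z hz hz' => by
      have h1 : d < z := hz'
      have h2 : z < -d := hz
      omega) (-d - 1) (show -d - 1 < -d by omega)
  have hDt : 0 < ∑' x, D x := hsD.tsum_pos hD0 a (hDpos a hπa)
  have hlt : ∑' x, N x < ∑' x, D x := by
    refine Summable.tsum_lt_tsum (i := b) (fun x => ?_) ?_ hsN hsD
    · rw [← hND x]
      exact le_abs_self _
    · rw [hNm b hb]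
      linarith [hDpos b hπb]
  have hgt : ∑' x, -D x < ∑' x, N x := by
    refine Summable.tsum_lt_tsum (i := a) (fun x => ?_) ?_ hsD.neg hsN
    · rw [← hND x]
      exact neg_abs_le _
    · rw [hNp a ha]
      linarith [hDpos a hπa]
  rw [tsum_neg] at hgt
  rw [hγ]
  constructor
  · rw [lt_div_iff₀ hDt]
    linarith
  · rw [div_lt_one hDt]
    exact hlt
end
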